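/- arXiv:1108.0183 — 2 statements merged into one kernel-verified Lean document; each statement's English description precedes it below -/
import Mathlib

section
/- Let {a_n, b_n}_{n=1}^∞ be Jacobi parameters (a_n > 0, b_n real) with a_n → 1 and b_n → 0, and let p_n be the associated orthonormal polynomials; let p̃_n be the orthonormal polynomials of the free Jacobi matrix (a_n ≡ 1, b_n ≡ 0). Suppose that (a) Σ_{n=1}^∞ (|a_n − 1|² + |b_n|²) < ∞, and (b) the partial sums Σ_{n=1}^N (a_n − 1) and Σ_{n=1}^N b_n have finite limits as N → ∞. Then for every x ∈ ℂ∖ℝ the limit lim_{n→∞} p_n(x)/p̃_n(x) exists and is finite, and the convergence is uniform on compact subsets of ℂ∖ℝ. -/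
open Filter Topology

lemma sz_energy (ρ η B X Y X' Y' : ℝ) (h0 : 0 ≤ ρ) (h1 : ρ < 1) (hη : 0 ≤ η) (hB : η ^ 2 ≤ B)
    (_hX : 0 ≤ X) (hY : 0 ≤ Y) (hX0 : 0 ≤ X') (hY0 : 0 ≤ Y')
    (hX' : X' ≤ ρ * X + η * (X + Y)) (hY' : Y' ≤ Y + η ^ 2 * Y + η * X) :
    X' ^ 2 ≤ ρ * X ^ 2 + 2 * (1 - ρ)⁻¹ * (X ^ 2 + Y ^ 2) * η ^ 2 ∧
    X' ^ 2 + Y' ^ 2 ≤ (1 + (2 * (1 - ρ)⁻¹ + (2 + B) + (1 + B) ^ 2 * (1 - ρ)⁻¹ + 1) * η ^ 2)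
      * (X ^ 2 + Y ^ 2) := by
  have hk : 0 < 1 - ρ := by linarith
  obtain ⟨k, hkdef⟩ : ∃ k, k = (1 - ρ)⁻¹ := ⟨_, rfl⟩
  have hkk : k * (1 - ρ) = 1 := by rw [hkdef]; field_simp
  have hkpos : 0 < k := by rw [hkdef]; positivity
  rw [← hkdef]
  have e1 : X' ^ 2 ≤ (ρ * X + η * (X + Y)) ^ 2 := by gcongr
  have e2 : (ρ * X + η * (X + Y)) ^ 2 ≤ ρ * X ^ 2 + k * (η * (X + Y)) ^ 2 := by
    obtain ⟨v, hv⟩ : ∃ v, v = k * (η * (X + Y)) := ⟨_, rfl⟩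
    have hv2 : η * (X + Y) = (1 - ρ) * v := by
      rw [hv]; linear_combination (-η * (X + Y)) * hkk
    have : k * (η * (X + Y)) ^ 2 = (1 - ρ) * v ^ 2 := by
      rw [hv2]; linear_combination ((1 - ρ) * v ^ 2) * hkk
    rw [this, hv2]
    nlinarith [mul_nonneg (mul_nonneg h0 hk.le) (sq_nonneg (X - v))]
  have e3 : k * (η * (X + Y)) ^ 2 ≤ 2 * k * (X ^ 2 + Y ^ 2) * η ^ 2 := by
    nlinarith [mul_nonneg (mul_nonneg hkpos.le (sq_nonneg η)) (sq_nonneg (X - Y))]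
  have e4 : X' ^ 2 ≤ ρ * X ^ 2 + 2 * k * (X ^ 2 + Y ^ 2) * η ^ 2 := by linarith
  refine ⟨e4, ?_⟩
  have hB0 : 0 ≤ B := le_trans (sq_nonneg η) hB
  have f1 : Y' ^ 2 ≤ (Y + η ^ 2 * Y + η * X) ^ 2 := by gcongr
  have f2 : (Y + η ^ 2 * Y + η * X) ^ 2
      = (1 + η ^ 2) ^ 2 * Y ^ 2 + 2 * ((1 + η ^ 2) * η * Y) * X + η ^ 2 * X ^ 2 := by ring
  have f3 : (1 + η ^ 2) ^ 2 * Y ^ 2 ≤ (1 + (2 + B) * η ^ 2) * Y ^ 2 := by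
    gcongr; nlinarith [sq_nonneg η]
  have f4 : 2 * ((1 + η ^ 2) * η * Y) * X ≤ (1 - ρ) * X ^ 2 + k * ((1 + η ^ 2) * η * Y) ^ 2 := by
    generalize (1 + η ^ 2) * η * Y = u
    have : (1 - ρ) * (X - k * u) ^ 2 = (1 - ρ) * X ^ 2 + k * u ^ 2 - 2 * u * X := by
      linear_combination (k * u ^ 2 - 2 * u * X) * hkk
    nlinarith [mul_nonneg hk.le (sq_nonneg (X - k * u))]
  have f5 : k * ((1 + η ^ 2) * η * Y) ^ 2 ≤ k * ((1 + B) * η * Y) ^ 2 := by gcongr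
  have g : 0 ≤ ((2 + B) + (1 + B) ^ 2 * k) * η ^ 2 * X ^ 2 + η ^ 2 * Y ^ 2 := by positivity
  nlinarith

lemma sz_gronwall (ρ M : ℝ) (h0 : 0 ≤ ρ) (h1 : ρ < 1) (η : ℕ → ℝ) (hη : ∀ n, 0 ≤ η n)
    (hs : Summable fun n => η n ^ 2) :
    ∃ (R : ℝ) (y w : ℕ → ℝ), Summable w ∧ Summable y ∧ ∀ D H : ℕ → ℂ, ‖D 0‖ ≤ M → ‖H 0‖ ≤ M →
      (∀ n, ‖D (n + 1)‖ ≤ ρ * ‖D n‖ + η n * (‖D n‖ + ‖H n‖)) →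
      (∀ n, ‖H (n + 1) - H n‖ ≤ η n ^ 2 * ‖H n‖ + η n * ‖D n‖) →
      ∀ n, ‖D n‖ ^ 2 ≤ y n ∧ ‖H (n + 1) - H n‖ ≤ w n ∧ ‖H n‖ ≤ R := by
  have hB : ∀ n, η n ^ 2 ≤ ∑' n, η n ^ 2 := fun n => hs.le_tsum n (fun _ _ => sq_nonneg _)
  obtain ⟨B, hBd⟩ : ∃ B, B = ∑' n, η n ^ 2 := ⟨_, rfl⟩
  rw [← hBd] at hB
  obtain ⟨C, hC⟩ : ∃ C, C = (2 * (1 - ρ)⁻¹ + (2 + B) + (1 + B) ^ 2 * (1 - ρ)⁻¹ + 1) := ⟨_, rfl⟩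
  have hB0 : 0 ≤ B := le_trans (sq_nonneg (η 0)) (hB 0)
  have hk : 0 < (1 - ρ)⁻¹ := inv_pos.2 (by linarith)
  have hC0 : 0 ≤ C := by rw [hC]; positivity
  obtain ⟨S, hS⟩ : ∃ S, S = 2 * M ^ 2 * Real.exp (C * B) := ⟨_, rfl⟩
  have hS0 : 0 ≤ S := by rw [hS]; positivity
  let y : ℕ → ℝ := fun n => Nat.rec (M ^ 2) (fun n t => ρ * t + 2 * (1 - ρ)⁻¹ * S * η n ^ 2) n
  have y0 : y 0 = M ^ 2 := rfl
  have yS : ∀ n, y (n + 1) = ρ * y n + 2 * (1 - ρ)⁻¹ * S * η n ^ 2 := fun n => rfl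
  have ypos : ∀ n, 0 ≤ y n := by
    intro n
    induction n with
    | zero => rw [y0]; positivity
    | succ n ih => rw [yS]; positivity
  have ysum : Summable y := by
    have key : ∀ n, (1 - ρ) * ∑ i ∈ Finset.range n, y i + y n
        = M ^ 2 + 2 * (1 - ρ)⁻¹ * S * ∑ i ∈ Finset.range n, η i ^ 2 := by
      intro n
      induction n with
      | zero => simp [y0]
      | succ n ih => rw [Finset.sum_range_succ, Finset.sum_range_succ, yS]; linear_combination ih
    refine summable_of_sum_range_le (c := (1 - ρ)⁻¹ * (M ^ 2 + 2 * (1 - ρ)⁻¹ * S * B)) ypos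
      fun n => ?_
    have h2 : ∑ i ∈ Finset.range n, η i ^ 2 ≤ B := by
      rw [hBd]; exact hs.sum_le_tsum _ (fun _ _ => sq_nonneg _)
    have h3 : (1 - ρ) * ∑ i ∈ Finset.range n, y i ≤ M ^ 2 + 2 * (1 - ρ)⁻¹ * S * B := by
      have : 2 * (1 - ρ)⁻¹ * S * ∑ i ∈ Finset.range n, η i ^ 2 ≤ 2 * (1 - ρ)⁻¹ * S * B := by gcongr
      have := key n
      have := ypos n
      linarith
    rw [inv_mul_eq_div, le_div_iff₀ (by linarith)]
    linarith
  refine ⟨1 + S, y, fun n => η n ^ 2 * (1 + S) + (η n ^ 2 + y n), ?_, ysum, ?_⟩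
  · exact (hs.mul_right _).add (hs.add ysum)
  intro D H hD0 hH0 hD hH
  have hen := fun n => sz_energy ρ (η n) B ‖D n‖ ‖H n‖ ‖D (n + 1)‖ ‖H (n + 1)‖ h0 h1 (hη n) (hB n)
    (norm_nonneg _) (norm_nonneg _) (norm_nonneg _) (norm_nonneg _) (hD n) (by
      have := norm_sub_norm_le (H (n + 1)) (H n)
      have := hH n
      linarith)
  rw [← hC] at hen
  have hSn : ∀ n, ‖D n‖ ^ 2 + ‖H n‖ ^ 2 ≤
      2 * M ^ 2 * Real.exp (C * ∑ i ∈ Finset.range n, η i ^ 2) := by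
    intro n
    induction n with
    | zero =>
      have : ‖D 0‖ ^ 2 ≤ M ^ 2 := by gcongr
      have : ‖H 0‖ ^ 2 ≤ M ^ 2 := by gcongr
      simp; linarith
    | succ n ih =>
      refine (hen n).2.trans ?_
      rw [Finset.sum_range_succ, mul_add C, Real.exp_add]
      have : 1 + C * η n ^ 2 ≤ Real.exp (C * η n ^ 2) := by
        linarith [Real.add_one_le_exp (C * η n ^ 2)]
      calc _ ≤ Real.exp (C * η n ^ 2) * (2 * M ^ 2 * Real.exp (C * ∑ i ∈ Finset.range n, η i ^ 2)) := by
            gcongr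
        _ = _ := by ring
  have hSS : ∀ n, ‖D n‖ ^ 2 + ‖H n‖ ^ 2 ≤ S := by
    intro n
    refine (hSn n).trans ?_
    rw [hS]
    have h2 : ∑ i ∈ Finset.range n, η i ^ 2 ≤ B := by
      rw [hBd]; exact hs.sum_le_tsum _ (fun _ _ => sq_nonneg _)
    gcongr
  have hDy : ∀ n, ‖D n‖ ^ 2 ≤ y n := by
    intro n
    induction n with
    | zero => rw [y0]; gcongr
    | succ n ih =>
      rw [yS]
      refine (hen n).1.trans ?_
      have := hSS n
      gcongr
  intro n
  have hHR : ‖H n‖ ≤ 1 + S := by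
    have := hSS n
    nlinarith [sq_nonneg (‖H n‖ - 1), sq_nonneg ‖D n‖, sq_nonneg ‖H n‖]
  refine ⟨hDy n, (hH n).trans ?_, hHR⟩
  have := hDy n
  have : η n * ‖D n‖ ≤ η n ^ 2 + y n := by
    nlinarith [sq_nonneg (η n - ‖D n‖), sq_nonneg (η n), sq_nonneg ‖D n‖]
  change _ ≤ η n ^ 2 * (1 + S) + (η n ^ 2 + y n)
  gcongr

/-- Uniform convergence on `K` with an explicit rate and a bounded limit. -/
def SzUC (K : Set ℂ) (F : ℕ → ℂ → ℂ) : Prop :=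
  ∃ (L : ℂ → ℂ) (M : ℝ) (t : ℕ → ℝ), (∀ x ∈ K, ‖L x‖ ≤ M) ∧ Tendsto t atTop (𝓝 0) ∧
    ∀ n, ∀ x ∈ K, ‖F n x - L x‖ ≤ t n

lemma SzUC.add {K : Set ℂ} {F G : ℕ → ℂ → ℂ} (hF : SzUC K F) (hG : SzUC K G) :
    SzUC K (fun n x => F n x + G n x) := by
  obtain ⟨L, M, t, h1, h2, h3⟩ := hF
  obtain ⟨L', M', t', h1', h2', h3'⟩ := hG
  refine ⟨fun x => L x + L' x, M + M', fun n => t n + t' n, ?_, by simpa using h2.add h2', ?_⟩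
  · intro x hx
    exact (norm_add_le _ _).trans (add_le_add (h1 x hx) (h1' x hx))
  · intro n x hx
    have : F n x + G n x - (L x + L' x) = (F n x - L x) + (G n x - L' x) := by ring
    rw [this]
    exact (norm_add_le _ _).trans (add_le_add (h3 n x hx) (h3' n x hx))

lemma SzUC.mul {K : Set ℂ} {F G : ℕ → ℂ → ℂ} (hF : SzUC K F) (hG : SzUC K G) :
    SzUC K (fun n x => F n x * G n x) := by
  obtain ⟨L, M, t, h1, h2, h3⟩ := hF
  obtain ⟨L', M', t', h1', h2', h3'⟩ := hG
  refine ⟨fun x => L x * L' x, M * M', fun n => t n * t' n + M * t' n + t n * M', ?_, ?_, ?_⟩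
  · intro x hx
    rw [norm_mul]
    have := (norm_nonneg _).trans (h1 x hx)
    exact mul_le_mul (h1 x hx) (h1' x hx) (norm_nonneg _) this
  · simpa using ((h2.mul h2').add (h2'.const_mul M)).add (h2.mul_const M')
  · intro n x hx
    have : F n x * G n x - L x * L' x = (F n x - L x) * (G n x - L' x) + L x * (G n x - L' x)
      + (F n x - L x) * L' x := by ring
    rw [this]
    have a1 := h1 x hx
    have a2 := h1' x hx
    have a3 := h3 n x hx
    have a4 := h3' n x hx
    have b1 := (norm_nonneg _).trans a1
    have b3 := (norm_nonneg _).trans a3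
    refine (norm_add₃_le).trans ?_
    rw [norm_mul, norm_mul, norm_mul]
    exact add_le_add (add_le_add (mul_le_mul a3 a4 (norm_nonneg _) b3)
      (mul_le_mul a1 a4 (norm_nonneg _) b1)) (mul_le_mul a3 a2 (norm_nonneg _) b3)

lemma SzUC.congr {K : Set ℂ} {F G : ℕ → ℂ → ℂ} (hF : SzUC K F)
    (h : ∀ n, ∀ x ∈ K, G n x = F n x) : SzUC K G := by
  obtain ⟨L, M, t, h1, h2, h3⟩ := hF
  exact ⟨L, M, t, h1, h2, fun n x hx => by rw [h n x hx]; exact h3 n x hx⟩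

lemma SzUC.const {K : Set ℂ} (g : ℂ → ℂ) (M : ℝ) (h : ∀ x ∈ K, ‖g x‖ ≤ M) :
    SzUC K (fun _ x => g x) :=
  ⟨g, M, fun _ => 0, h, tendsto_const_nhds, fun n x _ => by simp⟩

lemma SzUC.seq {K : Set ℂ} (c : ℕ → ℝ) (l : ℝ) (h : Tendsto c atTop (𝓝 l)) :
    SzUC K (fun n _ => (c n : ℂ)) := by
  refine ⟨fun _ => l, |l|, fun n => |c n - l|, fun x _ => by simp, ?_, fun n x _ => ?_⟩
  · have : Tendsto (fun n => c n - l) atTop (𝓝 0) := by simpa using h.sub_const l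
    simpa using this.abs
  · rw [← Complex.ofReal_sub, Complex.norm_real, Real.norm_eq_abs]

lemma SzUC.exp {K : Set ℂ} {F : ℕ → ℂ → ℂ} (hF : SzUC K F) :
    SzUC K (fun n x => Complex.exp (F n x)) := by
  obtain ⟨L, M, t, h1, h2, h3⟩ := hF
  refine ⟨fun x => Complex.exp (L x), Real.exp M, fun n => Real.exp M * (t n * Real.exp (t n)),
    ?_, ?_, ?_⟩
  · intro x hx
    exact (Complex.norm_exp_le_exp_norm _).trans (Real.exp_le_exp.2 (h1 x hx))
  · simpa using (h2.mul (Real.continuous_exp.continuousAt.tendsto.comp h2)).const_mul (Real.exp M)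
  · intro n x hx
    have : Complex.exp (F n x) - Complex.exp (L x)
        = Complex.exp (L x) * (Complex.exp (F n x - L x) - 1) := by
      rw [mul_sub, ← Complex.exp_add]; simp
    rw [this, norm_mul]
    have a1 := (Complex.norm_exp_le_exp_norm (L x)).trans (Real.exp_le_exp.2 (h1 x hx))
    have a2 := Complex.norm_exp_sub_sum_le_norm_mul_exp (F n x - L x) 1
    simp at a2
    have a3 := h3 n x hx
    have b3 := (norm_nonneg _).trans a3
    refine mul_le_mul a1 (a2.trans ?_) (norm_nonneg _) (Real.exp_pos _).le
    gcongr

lemma SzUC.of_increments {K : Set ℂ} {H : ℕ → ℂ → ℂ} (w : ℕ → ℝ) (R : ℝ) (hw : Summable w)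
    (h : ∀ n, ∀ x ∈ K, ‖H (n + 1) x - H n x‖ ≤ w n) (hR : ∀ n, ∀ x ∈ K, ‖H n x‖ ≤ R) :
    SzUC K H := by
  have hd : ∀ x ∈ K, ∀ n, dist (H n x) (H n.succ x) ≤ w n := fun x hx n => by
    rw [dist_comm, dist_eq_norm]; exact h n x hx
  have hl : ∀ x ∈ K, ∃ l, Tendsto (fun n => H n x) atTop (𝓝 l) := fun x hx =>
    cauchySeq_tendsto_of_complete (cauchySeq_of_dist_le_of_summable w (hd x hx) hw)
  choose! L hL using hl
  refine ⟨L, R, fun n => ∑' m, w (n + m), ?_, ?_, ?_⟩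
  · intro x hx
    exact le_of_tendsto (hL x hx).norm (Eventually.of_forall fun n => hR n x hx)
  · simpa [add_comm] using tendsto_sum_nat_add w
  · intro n x hx
    rw [← dist_eq_norm]
    exact dist_le_tsum_of_dist_le_of_tendsto w (hd x hx) hw (hL x hx) n

lemma SzUC.tendsto {K : Set ℂ} {F : ℕ → ℂ → ℂ} (hF : SzUC K F) :
    ∃ L, TendstoUniformlyOn F L atTop K := by
  obtain ⟨L, M, t, h1, h2, h3⟩ := hF
  refine ⟨L, Metric.tendstoUniformlyOn_iff.2 fun ε hε => ?_⟩
  filter_upwards [h2.eventually (gt_mem_nhds hε)] with n hn x hx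
  rw [dist_comm, dist_eq_norm]
  exact (h3 n x hx).trans_lt hn

lemma sz_exp (s : ℂ) (m : ℝ) (h : ‖s‖ ≤ m) :
    ‖Complex.exp s * (1 - s) - 1‖ ≤ (Real.exp m * (1 + m) + 1) * ‖s‖ ^ 2 := by
  have a2 := Complex.norm_exp_sub_sum_le_norm_mul_exp s 2
  simp [Finset.sum_range_succ] at a2
  have : Complex.exp s * (1 - s) - 1 = (Complex.exp s - (1 + s)) * (1 - s) - s ^ 2 := by ring
  rw [this]
  have h1 : ‖1 - s‖ ≤ 1 + m := (norm_sub_le _ _).trans (by simpa using h)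
  calc _ ≤ ‖(Complex.exp s - (1 + s)) * (1 - s)‖ + ‖s ^ 2‖ := norm_sub_le _ _
    _ ≤ (‖s‖ ^ 2 * Real.exp m) * (1 + m) + ‖s‖ ^ 2 := by
      rw [norm_mul, norm_pow]
      gcongr
      exact a2.trans (by gcongr)
    _ = _ := by ring

lemma sz_core (K : Set ℂ) (r : ℝ) (hr0 : 0 ≤ r) (hr1 : r < 1) (w : ℂ → ℂ)
    (hw : ∀ x ∈ K, ‖w x‖ ≤ r) (e β : ℕ → ℝ)
    (he2 : Summable fun n => e n ^ 2) (hβ2 : Summable fun n => β n ^ 2)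
    (he : ∃ E, Tendsto (fun N => ∑ n ∈ Finset.range N, e n) atTop (𝓝 E))
    (hβ : ∃ E, Tendsto (fun N => ∑ n ∈ Finset.range N, β n) atTop (𝓝 E))
    (f d : ℕ → ℂ → ℂ) (hf0 : ∀ x ∈ K, f 0 x = 1) (hd0 : ∀ x ∈ K, d 0 x = 1)
    (hf : ∀ n, ∀ x ∈ K, f (n + 1) x = f n x + d (n + 1) x)
    (hd : ∀ n, ∀ x ∈ K, d (n + 1) x = w x ^ 2 * (1 + e n) * d n x
      - (β n * w x + e n * w x ^ 2) * f n x) : SzUC K f := by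
  obtain ⟨κ, hκ⟩ : ∃ κ, κ = (1 - r)⁻¹ := ⟨_, rfl⟩
  have hκ1 : 1 ≤ κ := by rw [hκ]; exact (one_le_inv₀ (by linarith)).2 (by linarith)
  let δ : ℕ → ℝ := fun n => |β n| + |e n|
  have hδ0 : ∀ n, 0 ≤ δ n := fun n => by positivity
  have hδs : Summable fun n => δ n ^ 2 := by
    refine Summable.of_nonneg_of_le (fun n => sq_nonneg _) (fun n => ?_)
      ((hβ2.add he2).mul_left 2)
    have := sq_abs (β n)
    have := sq_abs (e n)
    show (|β n| + |e n|) ^ 2 ≤ _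
    nlinarith [sq_nonneg (|β n| - |e n|)]
  obtain ⟨Δ, hΔ⟩ : ∃ Δ, ∀ n, δ n ≤ Δ := by
    refine ⟨1 + ∑' n, δ n ^ 2, fun n => ?_⟩
    have := hδs.le_tsum n (fun _ _ => sq_nonneg _)
    nlinarith [sq_nonneg (δ n - 1)]
  have hΔ0 : 0 ≤ Δ := (hδ0 0).trans (hΔ 0)
  -- elementary bounds
  have hw1 : ∀ x ∈ K, ‖w x‖ ≤ 1 := fun x hx => (hw x hx).trans hr1.le
  have hl : ∀ x ∈ K, ‖w x ^ 2‖ ≤ r := fun x hx => by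
    rw [norm_pow]; nlinarith [hw x hx, norm_nonneg (w x)]
  have hl1 : ∀ x ∈ K, 1 - r ≤ ‖1 - w x ^ 2‖ := fun x hx => by
    have := norm_sub_norm_le 1 (w x ^ 2)
    rw [norm_one] at this
    linarith [hl x hx]
  have hne : ∀ x ∈ K, 1 - w x ^ 2 ≠ 0 := fun x hx h => by
    have := hl1 x hx
    rw [h, norm_zero] at this; linarith
  have hinv : ∀ x ∈ K, ‖(1 - w x ^ 2)⁻¹‖ ≤ κ := fun x hx => by
    rw [norm_inv, hκ]; exact inv_anti₀ (by linarith) (hl1 x hx)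
  let μ : ℂ → ℂ := fun x => w x ^ 2 * (1 - w x ^ 2)⁻¹
  have hμ : ∀ x ∈ K, ‖μ x‖ ≤ κ := fun x hx => by
    show ‖w x ^ 2 * (1 - w x ^ 2)⁻¹‖ ≤ _
    rw [norm_mul]
    nlinarith [hl x hx, hinv x hx, norm_nonneg (w x ^ 2), norm_nonneg ((1 - w x ^ 2)⁻¹)]
  have hν : ∀ x ∈ K, ‖w x * (1 - w x ^ 2)⁻¹‖ ≤ κ := fun x hx => by
    rw [norm_mul]
    nlinarith [hw1 x hx, hinv x hx, norm_nonneg (w x), norm_nonneg ((1 - w x ^ 2)⁻¹)]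
  let ε : ℕ → ℂ → ℂ := fun n x => β n * w x + e n * w x ^ 2
  have hε : ∀ n, ∀ x ∈ K, ‖ε n x‖ ≤ δ n := fun n x hx => by
    refine (norm_add_le _ _).trans ?_
    rw [norm_mul, norm_mul, Complex.norm_real, Complex.norm_real]
    have h1 := hw1 x hx
    have h2 := (hl x hx).trans hr1.le
    exact add_le_add (mul_le_of_le_one_right (abs_nonneg _) h1)
      (mul_le_of_le_one_right (abs_nonneg _) h2)
  let s : ℕ → ℂ → ℂ := fun n x => ε n x * (1 - w x ^ 2)⁻¹
  have hs : ∀ n, ∀ x ∈ K, ‖s n x‖ ≤ κ * δ n := fun n x hx => by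
    show ‖ε n x * (1 - w x ^ 2)⁻¹‖ ≤ _
    rw [norm_mul, mul_comm]
    exact mul_le_mul (hinv x hx) (hε n x hx) (norm_nonneg _) (by linarith)
  let σ : ℕ → ℂ → ℂ := fun n x => ((∑ k ∈ Finset.range n, β k : ℝ) : ℂ) * (w x * (1 - w x ^ 2)⁻¹)
    + ((∑ k ∈ Finset.range n, e k : ℝ) : ℂ) * μ x
  have hσS : ∀ n x, σ (n + 1) x = σ n x + s n x := fun n x => by
    simp only [σ, s, ε, μ, Finset.sum_range_succ, Complex.ofReal_add]; ring
  have hσ0 : ∀ x, σ 0 x = 0 := fun x => by simp [σ]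
  obtain ⟨E1, hE1⟩ := he
  obtain ⟨E2, hE2⟩ := hβ
  have hσU : SzUC K σ :=
    ((SzUC.seq _ _ hE2).mul (SzUC.const _ κ hν)).add ((SzUC.seq _ _ hE1).mul (SzUC.const _ κ hμ))
  obtain ⟨T, hT⟩ : ∃ T, ∀ n, ∀ x ∈ K, ‖σ n x‖ ≤ T := by
    obtain ⟨L, M, t, h1, h2, h3⟩ := hσU
    obtain ⟨t', ht'⟩ := h2.bddAbove_range
    refine ⟨M + t', fun n x hx => ?_⟩
    have a := h1 x hx
    have b := h3 n x hx
    have c : t n ≤ t' := ht' ⟨n, rfl⟩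
    have := norm_le_norm_add_norm_sub' (σ n x) (L x)
    linarith
  have hexp : ∀ n, ∀ x ∈ K, ‖Complex.exp (σ n x)‖ ≤ Real.exp T := fun n x hx =>
    (Complex.norm_exp_le_exp_norm _).trans (Real.exp_le_exp.2 (hT n x hx))
  have hexp' : ∀ n, ∀ x ∈ K, ‖Complex.exp (-σ n x)‖ ≤ Real.exp T := fun n x hx =>
    (Complex.norm_exp_le_exp_norm _).trans (Real.exp_le_exp.2 (by rw [norm_neg]; exact hT n x hx))
  let G : ℕ → ℂ → ℂ := fun n x => f n x + μ x * d n x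
  let H : ℕ → ℂ → ℂ := fun n x => Complex.exp (σ n x) * G n x
  have hGH : ∀ n x, G n x = Complex.exp (-σ n x) * H n x := fun n x => by
    simp only [H]; rw [← mul_assoc, ← Complex.exp_add]; simp
  have hfG : ∀ n x, f n x = G n x - μ x * d n x := fun n x => by simp only [G]; ring
  obtain ⟨Q, hQ⟩ : ∃ Q, Q = Real.exp (κ * Δ) * (1 + κ * Δ) + 1 := ⟨_, rfl⟩
  have hQ1 : 1 ≤ Q := by
    have : 0 ≤ Real.exp (κ * Δ) * (1 + κ * Δ) := by positivity
    linarith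
  obtain ⟨C, hC⟩ : ∃ C, C = 2 * κ ^ 2 * Real.exp T + 2 * κ + κ * Q := ⟨_, rfl⟩
  have hTpos := Real.exp_pos T
  have hC0 : 0 ≤ C := by rw [hC]; positivity
  have hC1 : 2 * κ ^ 2 * Real.exp T ≤ C := by
    have : 0 ≤ 2 * κ + κ * Q := by positivity
    linarith
  have hC2 : 2 * κ ≤ C := by
    have : 0 ≤ 2 * κ ^ 2 * Real.exp T + κ * Q := by positivity
    linarith
  have hC3 : κ * Q ≤ C := by
    have : 0 ≤ 2 * κ ^ 2 * Real.exp T + 2 * κ := by positivity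
    linarith
  have hC4 : κ ^ 2 * Q ≤ C ^ 2 := by
    calc κ ^ 2 * Q ≤ κ ^ 2 * (Q * Q) := by gcongr; nlinarith
      _ = (κ * Q) ^ 2 := by ring
      _ ≤ C ^ 2 := by gcongr
  have hC5 : Real.exp T ≤ C := by
    have : (1 : ℝ) ≤ 2 * κ ^ 2 := by nlinarith
    nlinarith
  obtain ⟨R, y, v, hv, hy, hmain⟩ := sz_gronwall r (1 + κ) hr0 hr1 (fun n => C * δ n)
    (fun n => mul_nonneg hC0 (hδ0 n)) (by simpa only [mul_pow] using hδs.mul_left (C ^ 2))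
  have hall : ∀ x ∈ K, ∀ n, ‖d n x‖ ^ 2 ≤ y n ∧ ‖H (n + 1) x - H n x‖ ≤ v n ∧ ‖H n x‖ ≤ R := by
    intro x hx
    refine hmain (fun n => d n x) (fun n => H n x) ?_ ?_ ?_ ?_
    · simp only [hd0 x hx, norm_one]; linarith
    · simp only [H, G, hσ0, Complex.exp_zero, one_mul, hf0 x hx, hd0 x hx, mul_one]
      exact (norm_add_le _ _).trans (by simpa using hμ x hx)
    · intro n
      have e1 : d (n + 1) x = w x ^ 2 * d n x + (w x ^ 2 * e n + ε n x * μ x) * d n x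
          - ε n x * Complex.exp (-σ n x) * H n x := by
        rw [mul_assoc (ε n x), ← hGH, hd n x hx, hfG n x]; simp only [ε]; ring
      have b1 : ‖w x ^ 2 * e n + ε n x * μ x‖ ≤ C * δ n := by
        refine (norm_add_le _ _).trans ?_
        rw [norm_mul, norm_mul, Complex.norm_real]
        have i1 : ‖w x ^ 2‖ * ‖e n‖ ≤ 1 * δ n :=
          mul_le_mul ((hl x hx).trans hr1.le) (le_add_of_nonneg_left (abs_nonneg _))
            (norm_nonneg _) (by norm_num)
        have i2 : ‖ε n x‖ * ‖μ x‖ ≤ δ n * κ :=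
          mul_le_mul (hε n x hx) (hμ x hx) (norm_nonneg _) (hδ0 n)
        nlinarith [hδ0 n]
      have b2 : ‖ε n x * Complex.exp (-σ n x)‖ ≤ C * δ n := by
        rw [norm_mul, mul_comm]
        exact mul_le_mul ((hexp' n x hx).trans hC5) (hε n x hx) (norm_nonneg _) hC0
      show ‖d (n + 1) x‖ ≤ r * ‖d n x‖ + C * δ n * (‖d n x‖ + ‖H n x‖)
      rw [e1]
      calc _ ≤ ‖w x ^ 2 * d n x‖ + ‖(w x ^ 2 * e n + ε n x * μ x) * d n x‖
            + ‖ε n x * Complex.exp (-σ n x) * H n x‖ :=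
            (norm_sub_le _ _).trans (add_le_add (norm_add_le _ _) le_rfl)
        _ ≤ r * ‖d n x‖ + C * δ n * ‖d n x‖ + C * δ n * ‖H n x‖ := by
          rw [norm_mul, norm_mul, norm_mul (ε n x * Complex.exp (-σ n x))]
          have := hl x hx
          gcongr
        _ = _ := by ring
    · intro n
      have hG : G (n + 1) x = G n x * (1 - s n x)
          + (w x ^ 2 * e n + ε n x * μ x) * (1 - w x ^ 2)⁻¹ * d n x := by
        have hn := hne x hx
        simp only [G, s, ε, μ]
        rw [hf n x hx, hd n x hx]
        field_simp
        ring
      have e1 : H (n + 1) x - H n x = (Complex.exp (s n x) * (1 - s n x) - 1) * H n x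
          + Complex.exp (σ (n + 1) x) * ((w x ^ 2 * e n + ε n x * μ x) * (1 - w x ^ 2)⁻¹) * d n x := by
        simp only [H]
        rw [hG, hσS, Complex.exp_add]; ring
      have b1 : ‖w x ^ 2 * e n + ε n x * μ x‖ ≤ 2 * κ * δ n := by
        refine (norm_add_le _ _).trans ?_
        rw [norm_mul, norm_mul, Complex.norm_real]
        have i1 : ‖w x ^ 2‖ * ‖e n‖ ≤ 1 * δ n :=
          mul_le_mul ((hl x hx).trans hr1.le) (le_add_of_nonneg_left (abs_nonneg _))
            (norm_nonneg _) (by norm_num)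
        have i2 : ‖ε n x‖ * ‖μ x‖ ≤ δ n * κ :=
          mul_le_mul (hε n x hx) (hμ x hx) (norm_nonneg _) (hδ0 n)
        nlinarith [hδ0 n]
      have b2 : ‖Complex.exp (σ (n + 1) x) * ((w x ^ 2 * e n + ε n x * μ x) * (1 - w x ^ 2)⁻¹)‖
          ≤ C * δ n := by
        rw [norm_mul, norm_mul]
        calc _ ≤ Real.exp T * (2 * κ * δ n * κ) := by
              have := hexp (n + 1) x hx
              have := hinv x hx
              have := hδ0 n
              gcongr
          _ = 2 * κ ^ 2 * Real.exp T * δ n := by ring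
          _ ≤ C * δ n := by have := hδ0 n; gcongr
      have b3 : ‖Complex.exp (s n x) * (1 - s n x) - 1‖ ≤ (C * δ n) ^ 2 := by
        have i1 : ‖s n x‖ ≤ κ * Δ := (hs n x hx).trans (by have := hΔ n; gcongr)
        refine (sz_exp _ _ i1).trans ?_
        rw [← hQ]
        calc Q * ‖s n x‖ ^ 2 ≤ Q * (κ * δ n) ^ 2 := by have := hs n x hx; gcongr
          _ = κ ^ 2 * Q * δ n ^ 2 := by ring
          _ ≤ C ^ 2 * δ n ^ 2 := by gcongr
          _ = _ := by ring
      show ‖H (n + 1) x - H n x‖ ≤ (C * δ n) ^ 2 * ‖H n x‖ + C * δ n * ‖d n x‖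
      rw [e1]
      refine (norm_add_le _ _).trans ?_
      rw [norm_mul, norm_mul _ (d n x)]
      gcongr
  have hHU : SzUC K H := SzUC.of_increments v R hv (fun n x hx => (hall x hx n).2.1)
    (fun n x hx => (hall x hx n).2.2)
  have hdU : SzUC K d := by
    refine ⟨fun _ => 0, 0, fun n => Real.sqrt (y n), fun x _ => by simp, ?_, fun n x hx => ?_⟩
    · have := (Real.continuous_sqrt.tendsto 0).comp hy.tendsto_atTop_zero
      rw [Real.sqrt_zero] at this
      exact this
    · rw [sub_zero]; exact Real.le_sqrt_of_sq_le (hall x hx n).1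
  have hnσ : SzUC K (fun n x => -σ n x) :=
    ((SzUC.const (fun _ => (-1 : ℂ)) 1 (by simp)).mul hσU).congr (fun n x _ => by ring)
  have hnμ : SzUC K (fun _ x => -μ x) :=
    SzUC.const (fun x => -μ x) κ (fun x hx => by rw [norm_neg]; exact hμ x hx)
  refine ((hnσ.exp.mul hHU).add (hnμ.mul hdU)).congr fun n x hx => ?_
  rw [← hGH, hfG]; ring

lemma sz_root (x : ℂ) (hx : x.im ≠ 0) :
    ∃ w : ℂ, x * w = w ^ 2 + 1 ∧ ‖w‖ * (2 + |x.im|) ≤ 2 := by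
  have key : ∀ w : ℂ, x * w = w ^ 2 + 1 → |x.im| * ‖w‖ ^ 2 = |w.im| * |1 - ‖w‖ ^ 2| := by
    intro w hw
    have h : (x.im : ℝ) * ‖w‖ ^ 2 = w.im * (‖w‖ ^ 2 - 1) := by
      have hn : ((‖w‖ ^ 2 : ℝ) : ℂ) = w * (starRingEnd ℂ) w := by
        rw [Complex.mul_conj, Complex.normSq_eq_norm_sq]
      have h1 : x * ((‖w‖ ^ 2 : ℝ) : ℂ) = w * ((‖w‖ ^ 2 : ℝ) : ℂ) + (starRingEnd ℂ) w := by
        rw [hn]; linear_combination ((starRingEnd ℂ) w) * hw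
      have h2 := congrArg Complex.im h1
      rw [Complex.add_im, Complex.im_mul_ofReal, Complex.im_mul_ofReal, Complex.conj_im] at h2
      linarith
    have h3 := congrArg abs h
    rw [abs_mul, abs_mul, abs_of_nonneg (sq_nonneg ‖w‖), abs_sub_comm] at h3
    exact h3
  have small : ∀ w : ℂ, x * w = w ^ 2 + 1 → ‖w‖ ≤ 1 → ‖w‖ * (2 + |x.im|) ≤ 2 := by
    intro w hw hle
    have h := key w hw
    have hw0 : w ≠ 0 := by rintro rfl; simp at hw
    have hpos : 0 < ‖w‖ := norm_pos_iff.2 hw0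
    rw [abs_of_nonneg (by nlinarith : 0 ≤ 1 - ‖w‖ ^ 2)] at h
    have h1 : |x.im| * ‖w‖ ^ 2 ≤ ‖w‖ * (1 - ‖w‖ ^ 2) := by
      rw [h]
      exact mul_le_mul_of_nonneg_right (Complex.abs_im_le_norm w) (by nlinarith)
    have h2 : |x.im| * ‖w‖ ≤ 1 - ‖w‖ ^ 2 := by
      refine le_of_mul_le_mul_left ?_ hpos
      linarith
    nlinarith
  obtain ⟨s, hs⟩ := IsAlgClosed.exists_pow_nat_eq (x ^ 2 - 4) (n := 2) (by norm_num)
  have hw : x * ((x + s) / 2) = ((x + s) / 2) ^ 2 + 1 := by linear_combination (-1 / 4 : ℂ) * hs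
  generalize (x + s) / 2 = w at hw
  rcases le_total ‖w‖ 1 with h | h
  · exact ⟨w, hw, small w hw h⟩
  · have hw0 : w ≠ 0 := by rintro rfl; simp at hw
    have hw' : x * w⁻¹ = w⁻¹ ^ 2 + 1 := by
      field_simp
      linear_combination hw
    exact ⟨w⁻¹, hw', small _ hw' (by rw [norm_inv]; exact inv_le_one_of_one_le₀ h)⟩

lemma sz_prod (a : ℕ → ℝ) (hapos : ∀ n, 1 ≤ n → 0 < a n)
    (ha1 : Tendsto a atTop (𝓝 1)) (hs : Summable fun n : ℕ => (a (n + 1) - 1) ^ 2)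
    (hA : ∃ A : ℝ, Tendsto (fun N => ∑ n ∈ Finset.range N, (a (n + 1) - 1)) atTop (𝓝 A)) :
    ∃ l, Tendsto (fun N => (∏ n ∈ Finset.range N, a (n + 1))⁻¹) atTop (𝓝 l) := by
  obtain ⟨A, hA⟩ := hA
  have hlog : Summable fun n : ℕ => Real.log (a (n + 1)) - (a (n + 1) - 1) := by
    refine Summable.of_norm_bounded_eventually_nat (hs.mul_left 2) ?_
    have h := ((tendsto_add_atTop_iff_nat 1).2 ha1).eventually (lt_mem_nhds
      (show (1 / 2 : ℝ) < 1 by norm_num))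
    filter_upwards [h] with n hn
    have hp : 0 < a (n + 1) := hapos _ (by omega)
    have h1 := Real.log_le_sub_one_of_pos hp
    have h2 := Real.one_sub_inv_le_log_of_pos hp
    rw [Real.norm_eq_abs, abs_sub_comm, abs_of_nonneg (by linarith)]
    generalize a (n + 1) = t at *
    have h3 : t - 1 - (1 - t⁻¹) = (t - 1) ^ 2 * t⁻¹ := by field_simp
    have h4 : t⁻¹ ≤ 2 := by
      rw [inv_le_comm₀ hp (by norm_num)]; linarith
    nlinarith [sq_nonneg (t - 1)]
  have h := hlog.hasSum.tendsto_sum_nat.add hA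
  refine ⟨_, ((Real.continuous_exp.tendsto _).comp h.neg).congr fun N => ?_⟩
  simp only [Function.comp]
  rw [← Finset.sum_add_distrib, Real.exp_neg, Real.exp_sum]
  congr 1
  refine Finset.prod_congr rfl fun n _ => ?_
  rw [sub_add_cancel, Real.exp_log (hapos _ (by omega))]

lemma sz_q (x w : ℂ) (hw : x * w = w ^ 2 + 1) (q : ℕ → ℂ) (h0 : q 0 = 1) (h1 : q 1 = x)
    (hq : ∀ n, 1 ≤ n → q (n + 1) = x * q n - q (n - 1)) (n : ℕ) :
    q n * w ^ n * (1 - w ^ 2) = 1 - (w ^ 2) ^ (n + 1) := by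
  induction n using Nat.twoStepInduction with
  | zero => rw [h0]; ring
  | one => rw [h1]; linear_combination (1 - w ^ 2) * hw
  | more n ih1 ih2 =>
    have := hq (n + 1) (by omega)
    simp only [Nat.add_sub_cancel] at this
    rw [this]
    linear_combination (x * w) * ih2 - w ^ 2 * ih1 + (1 - (w ^ 2) ^ (n + 2)) * hw

lemma sz_K (a b : ℕ → ℝ) (hapos : ∀ n, 1 ≤ n → 0 < a n)
    (ha1 : Tendsto a atTop (𝓝 1))
    (p : ℕ → ℂ → ℂ)
    (hp0 : ∀ x : ℂ, p 0 x = 1)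
    (hp1 : ∀ x : ℂ, (a 1 : ℂ) * p 1 x = x - (b 1 : ℂ))
    (hprec : ∀ n, 1 ≤ n → ∀ x : ℂ,
      (a (n + 1) : ℂ) * p (n + 1) x = (x - (b (n + 1) : ℂ)) * p n x - (a n : ℂ) * p (n - 1) x)
    (q : ℕ → ℂ → ℂ)
    (hq0 : ∀ x : ℂ, q 0 x = 1)
    (hq1 : ∀ x : ℂ, q 1 x = x)
    (hqrec : ∀ n, 1 ≤ n → ∀ x : ℂ, q (n + 1) x = x * q n x - q (n - 1) x)
    (hsa : Summable fun n : ℕ => (a (n + 1) - 1) ^ 2)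
    (hsb : Summable fun n : ℕ => b (n + 1) ^ 2)
    (hA : ∃ A : ℝ, Tendsto (fun N => ∑ n ∈ Finset.range N, (a (n + 1) - 1)) atTop (𝓝 A))
    (hB : ∃ B : ℝ, Tendsto (fun N => ∑ n ∈ Finset.range N, b (n + 1)) atTop (𝓝 B))
    (K : Set ℂ) (hK : K ⊆ {x : ℂ | x.im ≠ 0}) (hKc : IsCompact K) :
    SzUC K (fun n x => p n x / q n x) := by
  obtain ⟨δ, hδ, hδK⟩ : ∃ δ : ℝ, 0 < δ ∧ ∀ x ∈ K, δ ≤ |x.im| := by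
    obtain ⟨δ, h1, h2⟩ := hKc.exists_forall_le' (f := fun x : ℂ => |x.im|)
      (Complex.continuous_im.abs.continuousOn) (a := 0) (fun x hx => abs_pos.2 (hK hx))
    exact ⟨δ, h1, h2⟩
  have hroot : ∀ x ∈ K, ∃ w : ℂ, x * w = w ^ 2 + 1 ∧ ‖w‖ ≤ 2 / (2 + δ) := by
    intro x hx
    obtain ⟨w, h1, h2⟩ := sz_root x (hK hx)
    refine ⟨w, h1, ?_⟩
    rw [le_div_iff₀ (by linarith)]
    nlinarith [hδK x hx, norm_nonneg w]
  choose! w hw hwr using hroot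
  obtain ⟨r, hr⟩ : ∃ r, r = 2 / (2 + δ) := ⟨_, rfl⟩
  rw [← hr] at hwr
  have hr0 : 0 ≤ r := by rw [hr]; positivity
  have hr1 : r < 1 := by rw [hr, div_lt_one (by linarith)]; linarith
  let e : ℕ → ℝ := fun n => if n = 0 then 0 else a n ^ 2 - 1
  have eS : ∀ n, e (n + 1) = 2 * (a (n + 1) - 1) + (a (n + 1) - 1) ^ 2 := fun n => by
    simp only [e, Nat.succ_ne_zero, if_false]; ring
  have e0 : e 0 = 0 := by simp [e]
  have he2 : Summable fun n => e n ^ 2 := by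
    rw [← summable_nat_add_iff 1]
    obtain ⟨m, hm⟩ := ha1.bddAbove_range
    have hm' : ∀ n, a n ≤ m := fun n => hm ⟨n, rfl⟩
    refine Summable.of_nonneg_of_le (fun n => sq_nonneg _) (fun n => ?_) (hsa.mul_left ((1 + m) ^ 2))
    rw [eS]
    have h1 := hapos (n + 1) (by omega)
    have h2 := hm' (n + 1)
    have : (2 * (a (n + 1) - 1) + (a (n + 1) - 1) ^ 2) ^ 2
      = (1 + a (n + 1)) ^ 2 * (a (n + 1) - 1) ^ 2 := by ring
    rw [this]
    gcongr
  have hes : ∃ E, Tendsto (fun N => ∑ n ∈ Finset.range N, e n) atTop (𝓝 E) := by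
    obtain ⟨A, hA⟩ := hA
    refine ⟨2 * A + ∑' n, (a (n + 1) - 1) ^ 2, ?_⟩
    rw [← tendsto_add_atTop_iff_nat 1]
    refine ((hA.const_mul 2).add hsa.hasSum.tendsto_sum_nat).congr fun N => ?_
    rw [Finset.sum_range_succ', e0, add_zero, Finset.mul_sum, ← Finset.sum_add_distrib]
    exact Finset.sum_congr rfl fun n _ => (eS n).symm
  let A : ℕ → ℝ := fun N => ∏ n ∈ Finset.range N, a (n + 1)
  have AS : ∀ n, A (n + 1) = A n * a (n + 1) := fun n => Finset.prod_range_succ _ _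
  have A0 : A 0 = 1 := by simp [A]
  have Ane : ∀ n, A n ≠ 0 := fun n => Finset.prod_ne_zero_iff.2
    fun k _ => (hapos _ (by omega)).ne'
  let f : ℕ → ℂ → ℂ := fun n x => A n * p n x * w x ^ n
  let d : ℕ → ℂ → ℂ := fun n x => if n = 0 then 1 else f n x - f (n - 1) x
  have dS : ∀ n x, d (n + 1) x = f (n + 1) x - f n x := fun n x => by simp [d]
  have hfU : SzUC K f := by
    refine sz_core K r hr0 hr1 w hwr e (fun n => b (n + 1)) he2 hsb hes hB f d ?_ ?_ ?_ ?_
    · intro x _; simp [f, A0, hp0]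
    · intro x _; simp [d]
    · intro n x _; rw [dS]; ring
    · intro n x hx
      cases n with
      | zero =>
        have h := hp1 x
        have hx' := hw x hx
        rw [dS]
        simp only [f, AS, A0, hp0, e0, d]
        push_cast
        linear_combination (w x) * h + hx'
      | succ m =>
        have h := hprec (m + 1) (by omega) x
        have hx' := hw x hx
        try simp only [Nat.add_sub_cancel] at h
        rw [dS, dS, eS]
        simp only [f, AS]
        push_cast
        linear_combination ((A m : ℂ) * a (m + 1) * w x ^ (m + 2)) * h
          + ((A m : ℂ) * a (m + 1) * w x ^ (m + 1) * p (m + 1) x) * hx'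
  obtain ⟨l, hl⟩ := sz_prod a hapos ha1 hsa hA
  have hlam : ∀ x ∈ K, ‖w x ^ 2‖ ≤ r := fun x hx => by
    rw [norm_pow]; nlinarith [hwr x hx, norm_nonneg (w x)]
  have hlamn : ∀ x ∈ K, ∀ n : ℕ, ‖(w x ^ 2) ^ (n + 1)‖ ≤ r ^ (n + 1) := fun x hx n => by
    rw [norm_pow]; exact pow_le_pow_left₀ (norm_nonneg _) (hlam x hx) _
  have hden : ∀ x ∈ K, ∀ n : ℕ, 1 - r ≤ ‖1 - (w x ^ 2) ^ (n + 1)‖ := fun x hx n => by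
    have h1 := norm_sub_norm_le 1 ((w x ^ 2) ^ (n + 1))
    have h2 := hlamn x hx n
    have h3 : r ^ (n + 1) ≤ r := pow_le_of_le_one hr0 hr1.le (by omega)
    rw [norm_one] at h1
    linarith
  have hden0 : ∀ x ∈ K, ∀ n : ℕ, 1 - (w x ^ 2) ^ (n + 1) ≠ 0 := fun x hx n h => by
    have := hden x hx n
    rw [h, norm_zero] at this; linarith
  have hgU : SzUC K (fun n x => (1 - w x ^ 2) / (1 - (w x ^ 2) ^ (n + 1))) := by
    refine ⟨fun x => 1 - w x ^ 2, 2, fun n => 2 * r ^ (n + 1) / (1 - r), ?_, ?_, ?_⟩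
    · intro x hx
      refine (norm_sub_le _ _).trans ?_
      rw [norm_one]; linarith [hlam x hx]
    · have := (tendsto_add_atTop_iff_nat 1).2 (tendsto_pow_atTop_nhds_zero_of_lt_one hr0 hr1)
      simpa using (this.const_mul 2).div_const (1 - r)
    · intro n x hx
      have h0 := hden0 x hx n
      have : (1 - w x ^ 2) / (1 - (w x ^ 2) ^ (n + 1)) - (1 - w x ^ 2)
          = (1 - w x ^ 2) * (w x ^ 2) ^ (n + 1) / (1 - (w x ^ 2) ^ (n + 1)) := by
        rw [eq_div_iff h0, sub_mul, div_mul_cancel₀ _ h0]; ring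
      rw [this, norm_div, norm_mul]
      have h2 : ‖1 - w x ^ 2‖ ≤ 2 := by
        refine (norm_sub_le _ _).trans ?_
        rw [norm_one]; linarith [hlam x hx]
      exact div_le_div₀ (by positivity) (mul_le_mul h2 (hlamn x hx n) (norm_nonneg _) (by norm_num))
        (by linarith) (hden x hx n)
  refine ((hfU.mul (SzUC.seq _ _ hl)).mul hgU).congr fun n x hx => ?_
  have hq := sz_q x (w x) (hw x hx) (fun n => q n x) (hq0 x) (hq1 x) (fun n hn => hqrec n hn x) n
  have h0 := hden0 x hx n
  have hprod : q n x * w x ^ n * (1 - w x ^ 2) ≠ 0 := by rw [hq]; exact h0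
  have hqn : q n x ≠ 0 := fun h => hprod (by rw [h]; ring)
  have hA' : ((A n : ℝ) : ℂ) ≠ 0 := Complex.ofReal_ne_zero.2 (Ane n)
  change p n x / q n x = A n * p n x * w x ^ n * (((A n)⁻¹ : ℝ) : ℂ) * _
  rw [← hq]
  have hw1 : w x ^ n ≠ 0 := fun h => hprod (by rw [h]; ring)
  have hw2 : 1 - w x ^ 2 ≠ 0 := fun h => hprod (by rw [h]; ring)
  rw [Complex.ofReal_inv]
  field_simp

/-- **Damanik–Simon, hard direction.** Let `{a_n, b_n}_{n≥1}` be Jacobi parameters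
(`a_n > 0`, `b_n` real) with `a_n → 1`, `b_n → 0`, and let `p_n` be the associated
orthonormal polynomials (three-term recurrence with `p_{-1} = 0`, `p_0 = 1`, `a_0 = 1`);
let `q_n = p̃_n` be the orthonormal polynomials of the free Jacobi matrix (`a ≡ 1`, `b ≡ 0`).
If (a) `Σ (|a_n - 1|² + |b_n|²) < ∞` and (b) the partial sums `Σ_{n=1}^N (a_n - 1)` and
`Σ_{n=1}^N b_n` converge, then for every `x ∈ ℂ \ ℝ` the ratio `p_n(x)/q_n(x)` has a finite
limit as `n → ∞`, uniformly on compact subsets of `ℂ \ ℝ`. -/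
theorem szego_asymptotics_single_interval
    (a b : ℕ → ℝ) (hapos : ∀ n, 1 ≤ n → 0 < a n)
    (ha1 : Tendsto a atTop (𝓝 1)) (hb0 : Tendsto b atTop (𝓝 0))
    (p : ℕ → ℂ → ℂ)
    (hp0 : ∀ x : ℂ, p 0 x = 1)
    (hp1 : ∀ x : ℂ, (a 1 : ℂ) * p 1 x = x - (b 1 : ℂ))
    (hprec : ∀ n, 1 ≤ n → ∀ x : ℂ,
      (a (n + 1) : ℂ) * p (n + 1) x = (x - (b (n + 1) : ℂ)) * p n x - (a n : ℂ) * p (n - 1) x)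
    (q : ℕ → ℂ → ℂ)
    (hq0 : ∀ x : ℂ, q 0 x = 1)
    (hq1 : ∀ x : ℂ, q 1 x = x)
    (hqrec : ∀ n, 1 ≤ n → ∀ x : ℂ, q (n + 1) x = x * q n x - q (n - 1) x)
    (hsq : Summable fun n : ℕ => |a (n + 1) - 1| ^ 2 + |b (n + 1)| ^ 2)
    (hA : ∃ A : ℝ, Tendsto (fun N => ∑ n ∈ Finset.Icc 1 N, (a n - 1)) atTop (𝓝 A))
    (hB : ∃ B : ℝ, Tendsto (fun N => ∑ n ∈ Finset.Icc 1 N, b n) atTop (𝓝 B)) :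
    ∃ L : ℂ → ℂ,
      (∀ x : ℂ, x.im ≠ 0 → Tendsto (fun n => p n x / q n x) atTop (𝓝 (L x))) ∧
      (∀ K : Set ℂ, K ⊆ {x : ℂ | x.im ≠ 0} → IsCompact K →
        TendstoUniformlyOn (fun n x => p n x / q n x) L atTop K) := by
  have hIcc : ∀ (g : ℕ → ℝ) (N : ℕ), ∑ n ∈ Finset.Icc 1 N, g n = ∑ n ∈ Finset.range N, g (n + 1) := by
    intro g N
    rw [Finset.range_eq_Ico, Finset.sum_Ico_add' g 0 N 1]
    rfl
  simp only [hIcc] at hA hB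
  have hsa : Summable fun n : ℕ => (a (n + 1) - 1) ^ 2 :=
    Summable.of_nonneg_of_le (fun n => sq_nonneg _) (fun n => by
      rw [sq_abs]; linarith [sq_nonneg |b (n + 1)|]) hsq
  have hsb : Summable fun n : ℕ => b (n + 1) ^ 2 :=
    Summable.of_nonneg_of_le (fun n => sq_nonneg _) (fun n => by
      rw [sq_abs (b (n + 1))]; linarith [sq_nonneg |a (n + 1) - 1|]) hsq
  have main : ∀ K : Set ℂ, K ⊆ {x : ℂ | x.im ≠ 0} → IsCompact K →
      ∃ L, TendstoUniformlyOn (fun n x => p n x / q n x) L atTop K := fun K h1 h2 =>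
    (sz_K a b hapos ha1 p hp0 hp1 hprec q hq0 hq1 hqrec hsa hsb hA hB K h1 h2).tendsto
  have hpt : ∀ x : ℂ, x.im ≠ 0 → ∃ l, Tendsto (fun n => p n x / q n x) atTop (𝓝 l) := by
    intro x hx
    obtain ⟨L, hL⟩ := main {x} (by simpa using hx) isCompact_singleton
    exact ⟨L x, hL.tendsto_at rfl⟩
  choose! L hL using hpt
  refine ⟨L, hL, fun K h1 h2 => ?_⟩
  obtain ⟨L', hL'⟩ := main K h1 h2
  exact hL'.congr_right fun x hx => tendsto_nhds_unique (hL'.tendsto_at hx) (hL x (h1 hx))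
end

section
/- Let α ∈ (3/4, 1) and define δb_n = n^{−α} cos(2π√n) for n ≥ 1. Then: (i) Σ_{n=1}^∞ δb_n² < ∞ but Σ_{n=1}^∞ |δb_n| = ∞; (ii) for every ω ∈ [0,1] the series Σ_{n=1}^∞ e^{2πinω} δb_n converges (i.e., its partial sums have a finite limit); and (iii) the partial sums are uniformly bounded: there is a constant C < ∞ with sup_{ω∈[0,1]} sup_N |Σ_{n=1}^N e^{2πinω} δb_n| ≤ C. -/
open Filter Topology

/-- `e(x) = exp(2πix)`. -/
noncomputable def ee (x : ℝ) : ℂ := Complex.exp (((2 * Real.pi * x : ℝ) : ℂ) * Complex.I)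

lemma norm_ee (x : ℝ) : ‖ee x‖ = 1 := Complex.norm_exp_ofReal_mul_I _

lemma ee_add (x y : ℝ) : ee (x + y) = ee x * ee y := by
  unfold ee; rw [← Complex.exp_add]; push_cast; ring_nf

/-- Abstract summation by parts. -/
lemma kl_abstract (z : ℕ → ℂ) (hz : ∀ n, ‖z n‖ = 1) (t : ℕ → ℝ) (a b : ℕ) (hab : a < b)
    (hrel : ∀ n, a ≤ n → n < b → z n = (1 / 2 + (t n : ℂ) / 2 * Complex.I) * (z n - z (n + 1)))
    (ht : ∀ n, a ≤ n → n + 1 < b → t n ≤ t (n + 1)) :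
    ‖∑ n ∈ Finset.Ico a b, z n + (1 / 2 + (t (b - 1) : ℂ) / 2 * Complex.I) * z b
      - (1 / 2 + (t a : ℂ) / 2 * Complex.I) * z a‖ ≤ (t (b - 1) - t a) / 2 := by
  induction b, hab using Nat.le_induction with
  | base =>
    have := hrel a le_rfl (Nat.lt_succ_self a)
    simp only [Nat.succ_eq_add_one, Nat.add_sub_cancel, sub_self, zero_div]
    rw [Nat.Ico_succ_singleton, Finset.sum_singleton]
    rw [norm_le_zero_iff]
    linear_combination this
  | succ b hb ih =>
    have ih' := ih (fun n h1 h2 => hrel n h1 (by omega)) (fun n h1 h2 => ht n h1 (by omega))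
    have h1 := hrel b (by omega) (by omega)
    have h2 := ht (b - 1) (by omega) (by omega)
    rw [Nat.sub_add_cancel (by omega)] at h2
    rw [Finset.sum_Ico_succ_top (by omega), Nat.add_sub_cancel]
    have h3 : ∑ n ∈ Finset.Ico a b, z n + z b + (1 / 2 + (t b : ℂ) / 2 * Complex.I) * z (b + 1)
        - (1 / 2 + (t a : ℂ) / 2 * Complex.I) * z a
        = (∑ n ∈ Finset.Ico a b, z n + (1 / 2 + (t (b - 1) : ℂ) / 2 * Complex.I) * z b
      - (1 / 2 + (t a : ℂ) / 2 * Complex.I) * z a)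
        + (((t b - t (b - 1)) / 2 : ℝ) : ℂ) * (Complex.I * z b) := by
      push_cast
      linear_combination h1
    rw [h3]
    refine (norm_add_le _ _).trans ?_
    have h4 : ‖(((t b - t (b - 1)) / 2 : ℝ) : ℂ) * (Complex.I * z b)‖ = (t b - t (b - 1)) / 2 := by
      rw [norm_mul, norm_mul, hz, Complex.norm_I, Complex.norm_real, Real.norm_eq_abs,
        abs_of_nonneg (by linarith)]
      ring
    rw [h4]
    linarith

lemma kl_abstract' (z : ℕ → ℂ) (hz : ∀ n, ‖z n‖ = 1) (t : ℕ → ℝ) (a b : ℕ) (B : ℝ) (hB : 0 ≤ B)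
    (hrel : ∀ n, a ≤ n → n < b → z n = (1 / 2 + (t n : ℂ) / 2 * Complex.I) * (z n - z (n + 1)))
    (ht : ∀ n, a ≤ n → n + 1 < b → t n ≤ t (n + 1))
    (htB : ∀ n, a ≤ n → n < b → |t n| ≤ B) :
    ‖∑ n ∈ Finset.Ico a b, z n‖ ≤ 1 + 2 * B := by
  rcases le_or_gt b a with h | hab
  · rw [Finset.Ico_eq_empty (by omega)]; simp; linarith
  have h := kl_abstract z hz t a b hab hrel ht
  have hc : ∀ n m, a ≤ n → n < b → ‖(1 / 2 + (t n : ℂ) / 2 * Complex.I) * z m‖ ≤ 1 / 2 + B / 2 := by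
    intro n m h1 h2
    rw [norm_mul, hz, mul_one]
    refine (norm_add_le _ _).trans ?_
    have := htB n h1 h2
    simp
    linarith
  have h1 := hc (b - 1) b (by omega) (by omega)
  have h2 := hc a a (by omega) (by omega)
  have h3 := abs_le.1 (htB (b - 1) (by omega) (by omega))
  have h4 := abs_le.1 (htB a (by omega) (by omega))
  have h5 : ∑ n ∈ Finset.Ico a b, z n = (∑ n ∈ Finset.Ico a b, z n + (1 / 2 + (t (b - 1) : ℂ) / 2 * Complex.I) * z b
      - (1 / 2 + (t a : ℂ) / 2 * Complex.I) * z a) - (1 / 2 + (t (b - 1) : ℂ) / 2 * Complex.I) * z b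
      + (1 / 2 + (t a : ℂ) / 2 * Complex.I) * z a := by ring
  rw [h5]
  refine (norm_add_le _ _).trans ?_
  have := norm_sub_le (∑ n ∈ Finset.Ico a b, z n + (1 / 2 + (t (b - 1) : ℂ) / 2 * Complex.I) * z b
      - (1 / 2 + (t a : ℂ) / 2 * Complex.I) * z a) ((1 / 2 + (t (b - 1) : ℂ) / 2 * Complex.I) * z b)
  linarith

lemma sin_lower (x : ℝ) (h0 : 0 ≤ x) (h1 : x ≤ 3 / 4) : 2 / 3 * x ≤ Real.sin (Real.pi * x) := by
  have hp := Real.pi_pos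
  rcases le_or_gt x (1 / 2) with h | h
  · have := Real.mul_le_sin (x := Real.pi * x) (by positivity) (by nlinarith)
    have h2 : 2 / Real.pi * (Real.pi * x) = 2 * x := by field_simp
    linarith
  · have := Real.mul_le_sin (x := Real.pi * (1 - x)) (by apply mul_nonneg <;> linarith) (by nlinarith)
    have h2 : 2 / Real.pi * (Real.pi * (1 - x)) = 2 * (1 - x) := by field_simp
    have h3 : Real.sin (Real.pi * (1 - x)) = Real.sin (Real.pi * x) := by
      rw [show Real.pi * (1 - x) = Real.pi - Real.pi * x by ring, Real.sin_pi_sub]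
    linarith

lemma ee_rel (g : ℝ) (hs : Real.sin (Real.pi * g) ≠ 0) :
    (1 / 2 + ((Real.cos (Real.pi * g) / Real.sin (Real.pi * g) : ℝ) : ℂ) / 2 * Complex.I)
      * (1 - ee g) = 1 := by
  have h1 : ee g = ((Real.cos (Real.pi * g) : ℂ) + (Real.sin (Real.pi * g) : ℂ) * Complex.I) ^ 2 := by
    unfold ee
    rw [Complex.ofReal_cos, Complex.ofReal_sin, ← Complex.exp_mul_I, ← Complex.exp_nat_mul]
    push_cast; ring_nf
  have h2 : (Real.cos (Real.pi * g) : ℂ) ^ 2 + (Real.sin (Real.pi * g) : ℂ) ^ 2 = 1 := by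
    exact_mod_cast Real.cos_sq_add_sin_sq _
  have h3 : (Real.sin (Real.pi * g) : ℂ) ≠ 0 := by exact_mod_cast hs
  rw [h1]
  push_cast
  push_cast at h2 h3
  generalize Complex.cos (↑Real.pi * ↑g) = c at *
  generalize Complex.sin (↑Real.pi * ↑g) = s at *
  have hI := Complex.I_sq
  generalize Complex.I = i at *
  have h4 : (s + c * i) * (1 - (c + s * i) ^ 2) = 2 * s := by
    have : c ^ 2 = 1 - s ^ 2 := by linear_combination h2
    have hc3 : c ^ 3 = c * (1 - s ^ 2) := by rw [← this]; ring
    have hi3 : i ^ 3 = - i := by linear_combination i * hI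
    ring_nf
    simp only [hi3, hc3, this, hI]
    ring
  field_simp
  linear_combination h4

lemma sin_lower' (g δ : ℝ) (h0 : δ ≤ |g|) (h1 : |g| ≤ 3 / 4) :
    2 / 3 * δ ≤ |Real.sin (Real.pi * g)| := by
  have h := sin_lower |g| (abs_nonneg _) h1
  have h2 : |Real.sin (Real.pi * g)| = |Real.sin (Real.pi * |g|)| := by
    rcases abs_choice g with h | h <;> rw [h]
    rw [mul_neg, Real.sin_neg, abs_neg]
  rw [h2]
  have := le_abs_self (Real.sin (Real.pi * |g|))
  linarith

/-- Discrete Kuzmin–Landau inequality. -/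
lemma kuzmin_landau (F : ℕ → ℝ) (a b : ℕ) (δ : ℝ) (hδ : 0 < δ)
    (hg : (∀ n, a ≤ n → n < b → δ ≤ F (n + 1) - F n ∧ F (n + 1) - F n ≤ 3 / 4) ∨
      (∀ n, a ≤ n → n < b → F (n + 1) - F n ≤ -δ ∧ -(3 / 4) ≤ F (n + 1) - F n))
    (hanti : ∀ n, a ≤ n → n + 1 < b → F (n + 2) - F (n + 1) ≤ F (n + 1) - F n) :
    ‖∑ n ∈ Finset.Ico a b, ee (F n)‖ ≤ 1 + 3 / δ := by
  set g : ℕ → ℝ := fun n => F (n + 1) - F n with hgdef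
  have habs : ∀ n, a ≤ n → n < b → δ ≤ |g n| ∧ |g n| ≤ 3 / 4 := by
    intro n h1 h2
    rcases hg with h | h
    · have := h n h1 h2
      simp only [hgdef]
      rw [abs_of_nonneg (by linarith)]
      exact this
    · have := h n h1 h2
      simp only [hgdef]
      rw [abs_of_nonpos (by linarith)]
      constructor <;> linarith
  have hsin : ∀ n, a ≤ n → n < b → 2 / 3 * δ ≤ |Real.sin (Real.pi * g n)| := fun n h1 h2 =>
    sin_lower' _ _ (habs n h1 h2).1 (habs n h1 h2).2
  have hsin0 : ∀ n, a ≤ n → n < b → Real.sin (Real.pi * g n) ≠ 0 := fun n h1 h2 h => by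
    have := hsin n h1 h2
    rw [h, abs_zero] at this
    linarith
  have key := kl_abstract' (fun n => ee (F n)) (fun n => norm_ee _)
    (fun n => Real.cos (Real.pi * g n) / Real.sin (Real.pi * g n)) a b (3 / 2 / δ) (by positivity)
    ?_ ?_ ?_
  · calc _ ≤ _ := key
      _ = _ := by ring
  · intro n h1 h2
    have h := ee_rel (g n) (hsin0 n h1 h2)
    have h3 : ee (F (n + 1)) = ee (F n) * ee (g n) := by
      rw [← ee_add]; congr 1; simp only [hgdef]; ring
    simp only [h3]
    linear_combination (-ee (F n)) * h
  · intro n h1 h2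
    have hd : 0 ≤ g n - g (n + 1) := by
      have := hanti n h1 h2
      simp only [hgdef]; linarith
    have hd2 : g n - g (n + 1) ≤ 1 ∧ 0 < Real.sin (Real.pi * g n) * Real.sin (Real.pi * g (n + 1)) := by
      have hp := Real.pi_pos
      rcases hg with h | h
      · have e1 := h n h1 (by omega)
        have e2 := h (n + 1) (by omega) h2
        refine ⟨by simp only [hgdef]; linarith, ?_⟩
        apply mul_pos <;> apply Real.sin_pos_of_pos_of_lt_pi <;> simp only [hgdef] <;> nlinarith
      · have e1 := h n h1 (by omega)
        have e2 := h (n + 1) (by omega) h2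
        refine ⟨by simp only [hgdef]; linarith, ?_⟩
        apply mul_pos_of_neg_of_neg <;> apply Real.sin_neg_of_neg_of_neg_pi_lt <;> simp only [hgdef] <;> nlinarith
    have hs : 0 ≤ Real.sin (Real.pi * g n - Real.pi * g (n + 1)) := by
      have hp := Real.pi_pos
      apply Real.sin_nonneg_of_nonneg_of_le_pi <;> nlinarith [hd2.1]
    rw [Real.sin_sub] at hs
    have e : Real.cos (Real.pi * g (n + 1)) / Real.sin (Real.pi * g (n + 1))
      - Real.cos (Real.pi * g n) / Real.sin (Real.pi * g n)
      = (Real.sin (Real.pi * g n) * Real.cos (Real.pi * g (n + 1))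
        - Real.cos (Real.pi * g n) * Real.sin (Real.pi * g (n + 1)))
        / (Real.sin (Real.pi * g n) * Real.sin (Real.pi * g (n + 1))) := by
      have := hsin0 n h1 (by omega)
      have := hsin0 (n + 1) (by omega) h2
      field_simp
    have := div_nonneg hs hd2.2.le
    linarith
  · intro n h1 h2
    have h := hsin n h1 h2
    rw [abs_div, div_le_div_iff₀ (by linarith) hδ]
    have := Real.abs_cos_le_one (Real.pi * g n)
    nlinarith

lemma exists_split (g : ℕ → ℝ) (a b : ℕ) (hab : a ≤ b) (c : ℝ)
    (anti : ∀ m n, a ≤ m → m ≤ n → n < b → g n ≤ g m) :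
    ∃ p, a ≤ p ∧ p ≤ b ∧ (∀ n, a ≤ n → n < p → c < g n) ∧ (∀ n, p ≤ n → n < b → g n ≤ c) := by
  classical
  have hex : ∃ p, a ≤ p ∧ (p = b ∨ g p ≤ c) := ⟨b, hab, Or.inl rfl⟩
  have hle : Nat.find hex ≤ b := Nat.find_min' hex ⟨hab, Or.inl rfl⟩
  refine ⟨Nat.find hex, (Nat.find_spec hex).1, hle, ?_, ?_⟩
  · intro n h1 h2
    have := Nat.find_min hex h2
    push Not at this
    exact (this h1).2
  · intro n h1 h2
    rcases (Nat.find_spec hex).2 with h | h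
    · omega
    · exact (anti _ n (Nat.find_spec hex).1 h1 h2).trans h

/-- Discrete second derivative test. -/
lemma second_deriv_test (F : ℕ → ℝ) (a b : ℕ) (hab : a ≤ b) (δ l : ℝ) (hδ : 0 < δ) (hl : 0 < l)
    (hg : ∀ n, a ≤ n → n < b → |F (n + 1) - F n| ≤ 3 / 4)
    (hanti : ∀ n, a ≤ n → n + 1 < b → F (n + 2) - F (n + 1) ≤ F (n + 1) - F n - l) :
    ‖∑ n ∈ Finset.Ico a b, ee (F n)‖ ≤ 3 + 6 / δ + 2 * δ / l := by
  have hA : ∀ m n, a ≤ m → m ≤ n → n < b →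
      F (n + 1) - F n ≤ F (m + 1) - F m - l * ((n : ℝ) - m) := by
    intro m n h1 h2
    induction n, h2 using Nat.le_induction with
    | base => intro _; simp
    | succ n h ih =>
      intro h3
      have := ih (by omega)
      have := hanti n (by omega) h3
      push_cast
      have e : F (n + 1 + 1) = F (n + 2) := rfl
      rw [e]
      linarith
  have hA' : ∀ m n, a ≤ m → m ≤ n → n < b → F (n + 1) - F n ≤ F (m + 1) - F m := by
    intro m n h1 h2 h3
    have := hA m n h1 h2 h3
    have h4 : (m : ℝ) ≤ n := by exact_mod_cast h2
    nlinarith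
  obtain ⟨p, hap, hpb, hp1, hp2⟩ := exists_split (fun n => F (n + 1) - F n) a b hab δ hA'
  obtain ⟨q, hpq, hqb, hq1, hq2⟩ := exists_split (fun n => F (n + 1) - F n) p b hpb (-δ)
    (fun m n h1 h2 h3 => hA' m n (by omega) h2 h3)
  rw [← Finset.sum_Ico_consecutive _ hap hpb, ← Finset.sum_Ico_consecutive _ hpq hqb]
  have b1 : ‖∑ n ∈ Finset.Ico a p, ee (F n)‖ ≤ 1 + 3 / δ := by
    apply kuzmin_landau _ _ _ _ hδ
    · left
      intro n h1 h2
      exact ⟨(hp1 n h1 h2).le, (abs_le.1 (hg n h1 (by omega))).2⟩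
    · intro n h1 h2
      exact hA' n (n + 1) h1 (by omega) (by omega)
  have b3 : ‖∑ n ∈ Finset.Ico q b, ee (F n)‖ ≤ 1 + 3 / δ := by
    apply kuzmin_landau _ _ _ _ hδ
    · right
      intro n h1 h2
      exact ⟨(hq2 n h1 h2), (abs_le.1 (hg n (by omega) (by omega))).1⟩
    · intro n h1 h2
      exact hA' n (n + 1) (by omega) (by omega) (by omega)
  have b2 : ‖∑ n ∈ Finset.Ico p q, ee (F n)‖ ≤ 1 + 2 * δ / l := by
    have e1 : ‖∑ n ∈ Finset.Ico p q, ee (F n)‖ ≤ (q : ℝ) - p := by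
      refine (norm_sum_le _ _).trans ?_
      simp only [norm_ee]
      simp [Nat.cast_sub hpq]
    refine e1.trans ?_
    rcases hpq.eq_or_lt with h | h
    · rw [h, sub_self]; positivity
    · have := hA p (q - 1) (by omega) (by omega) (by omega)
      have u1 := hp2 p le_rfl (by omega)
      have u2 := hq1 (q - 1) (by omega) (by omega)
      have u3 : ((q - 1 : ℕ) : ℝ) = q - 1 := by rw [Nat.cast_sub (by omega)]; simp
      rw [u3] at this
      have : (q : ℝ) - 1 - p ≤ 2 * δ / l := by
        rw [le_div_iff₀ hl]; nlinarith
      linarith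
  have n1 := norm_add_le (∑ n ∈ Finset.Ico a p, ee (F n))
    (∑ n ∈ Finset.Ico p q, ee (F n) + ∑ n ∈ Finset.Ico q b, ee (F n))
  have n2 := norm_add_le (∑ n ∈ Finset.Ico p q, ee (F n)) (∑ n ∈ Finset.Ico q b, ee (F n))
  have : 6 / δ = 3 / δ + 3 / δ := by ring
  linarith

lemma ee_int (k : ℤ) : ee k = 1 := by
  unfold ee
  rw [Complex.exp_eq_one_iff]
  exact ⟨k, by push_cast; ring⟩

lemma second_diff (x y w s : ℝ) (hx : 0 < x) (hxy : x ≤ y) (hyw : y ≤ w) (hws : w ≤ s)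
    (h1 : y ^ 2 = x ^ 2 + 1) (h2 : w ^ 2 = y ^ 2 + 1) :
    1 / (4 * s ^ 3) ≤ (y - x) - (w - y) := by
  have e : (y - x) - (w - y) = 2 / ((w + x) * (y + x) * (w + y)) := by
    have a1 : y - x = 1 / (y + x) := by
      rw [eq_div_iff (by linarith)]; linarith
    have a2 : w - y = 1 / (w + y) := by
      rw [eq_div_iff (by linarith)]; linarith
    have a3 : (w + x) ≠ 0 := by linarith
    have a4 : (y + x) ≠ 0 := by linarith
    have a5 : (w + y) ≠ 0 := by linarith
    rw [a1, a2]
    field_simp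
    nlinarith
  rw [e, div_le_div_iff₀ (by have : 0 < s := by linarith
                             positivity) (by have : 0 < y := by linarith
                                             have : 0 < w := by linarith
                                             positivity)]
  have : (w + x) * (y + x) * (w + y) ≤ (2 * s) * (2 * s) * (2 * s) := by
    have hs0 : 0 < s := by linarith
    have hw0 : 0 < w := by linarith
    have hy0 : 0 < y := by linarith
    gcongr <;> linarith
  nlinarith

lemma expsum_aux (ω β : ℝ) (h1 : -(3 / 4) ≤ ω) (h2 : ω ≤ 1 / 4) (hβ1 : 1 ≤ β) (hβ2 : β ≤ 2)
    (M : ℕ) (hM : 4 ≤ M) (u : ℝ) (hu : 0 < u) (huM : u ^ 4 = M) :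
    ‖∑ n ∈ Finset.Ico 4 M, ee (ω * n + β * √(n : ℝ))‖ ≤ 3 + 14 * u ^ 3 := by
  have key := second_deriv_test (fun n => ω * n + β * √(n : ℝ)) 4 M hM (1 / u ^ 3) (1 / (4 * u ^ 6))
    (by positivity) (by positivity) ?_ ?_
  · refine key.trans (le_of_eq ?_)
    field_simp
    ring
  · intro n hn _
    have hn' : (4 : ℝ) ≤ n := by exact_mod_cast hn
    have a1 : 2 ≤ √(n : ℝ) := Real.le_sqrt_of_sq_le (by linarith)
    have a2 : √(n : ℝ) ≤ √((n : ℝ) + 1) := Real.sqrt_le_sqrt (by linarith)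
    have a3 : √(n : ℝ) ^ 2 = n := Real.sq_sqrt (by linarith)
    have a4 : √((n : ℝ) + 1) ^ 2 = n + 1 := Real.sq_sqrt (by linarith)
    have a5 : √((n : ℝ) + 1) - √(n : ℝ) ≤ 1 / 4 := by nlinarith
    have a6 : β * (√((n : ℝ) + 1) - √(n : ℝ)) ≤ 1 / 2 := by nlinarith
    have a7 : 0 ≤ β * (√((n : ℝ) + 1) - √(n : ℝ)) := mul_nonneg (by linarith) (by linarith)
    push_cast
    rw [abs_le]
    constructor <;> linarith
  · intro n hn hnM
    have hn' : (4 : ℝ) ≤ n := by exact_mod_cast hn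
    have hnM' : (n : ℝ) + 2 ≤ M := by exact_mod_cast hnM
    have b := second_diff (√(n : ℝ)) (√((n : ℝ) + 1)) (√((n : ℝ) + 2)) (u ^ 2)
      (Real.sqrt_pos.2 (by linarith)) (Real.sqrt_le_sqrt (by linarith))
      (Real.sqrt_le_sqrt (by linarith))
      (Real.sqrt_le_iff.2 ⟨by positivity, by nlinarith⟩)
      (by rw [Real.sq_sqrt (by linarith), Real.sq_sqrt (by linarith)])
      (by rw [Real.sq_sqrt (by linarith), Real.sq_sqrt (by linarith)]; ring)
    have e : 4 * (u ^ 2) ^ 3 = 4 * u ^ 6 := by ring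
    rw [e] at b
    have hpos : 0 < 1 / (4 * u ^ 6) := by positivity
    push_cast
    nlinarith

lemma expsum (ω β : ℝ) (hβ1 : 1 ≤ β) (hβ2 : β ≤ 2) (m : ℕ) :
    ‖∑ n ∈ Finset.range m, ee (ω * ((n + 1 : ℕ) : ℝ) + β * √((n + 1 : ℕ) : ℝ))‖
      ≤ 20 * ((m : ℝ) + 1) ^ (3 / 4 : ℝ) := by
  set u : ℝ := ((m : ℝ) + 1) ^ (1 / 4 : ℝ) with hu
  have hm0 : (0 : ℝ) ≤ m := Nat.cast_nonneg m
  have hu1 : 1 ≤ u := Real.one_le_rpow (by linarith) (by norm_num)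
  have hu4 : u ^ 4 = ((m + 1 : ℕ) : ℝ) := by
    rw [hu, ← Real.rpow_natCast, ← Real.rpow_mul (by linarith)]; norm_num
  have hu3 : ((m : ℝ) + 1) ^ (3 / 4 : ℝ) = u ^ 3 := by
    rw [hu, ← Real.rpow_natCast, ← Real.rpow_mul (by linarith)]; norm_num
  rw [hu3]
  have hu31 : 1 ≤ u ^ 3 := one_le_pow₀ hu1
  have hsh : ∑ n ∈ Finset.range m, ee (ω * ((n + 1 : ℕ) : ℝ) + β * √((n + 1 : ℕ) : ℝ))
      = ∑ n ∈ Finset.Ico 1 (m + 1), ee (ω * (n : ℝ) + β * √(n : ℝ)) := by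
    rw [Finset.sum_Ico_eq_sum_range]
    simp [add_comm]
  rw [hsh]
  have triv : ∀ a b : ℕ, ‖∑ n ∈ Finset.Ico a b, ee (ω * (n : ℝ) + β * √(n : ℝ))‖ ≤ ((b - a : ℕ) : ℝ) := by
    intro a b
    refine (norm_sum_le _ _).trans ?_
    simp only [norm_ee]
    simp
  rcases lt_or_ge m 3 with h | h
  · refine (triv _ _).trans ?_
    have : ((m + 1 - 1 : ℕ) : ℝ) ≤ 3 := by
      have : m + 1 - 1 ≤ 3 := by omega
      exact_mod_cast this
    linarith
  · rw [← Finset.sum_Ico_consecutive _ (show 1 ≤ 4 by norm_num) (show 4 ≤ m + 1 by omega)]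
    refine (norm_add_le _ _).trans ?_
    have t := triv 1 4
    norm_num at t
    have hred : ∀ n : ℕ, ee (ω * (n : ℝ) + β * √(n : ℝ))
        = ee ((Int.fract (ω + 3 / 4) - 3 / 4) * n + β * √(n : ℝ)) := by
      intro n
      have e : ω * (n : ℝ) + β * √(n : ℝ) = ((Int.fract (ω + 3 / 4) - 3 / 4) * n + β * √(n : ℝ))
          + ((⌊ω + 3 / 4⌋ * n : ℤ) : ℝ) := by
        have := Int.fract_add_floor (ω + 3 / 4)
        push_cast
        linear_combination (-(n : ℝ)) * this
      rw [e, ee_add, ee_int, mul_one]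
    have f0 := Int.fract_nonneg (ω + 3 / 4)
    have f1 := Int.fract_lt_one (ω + 3 / 4)
    have k := expsum_aux (Int.fract (ω + 3 / 4) - 3 / 4) β (by linarith) (by linarith) hβ1 hβ2
      (m + 1) (by omega) u (by linarith) hu4
    rw [Finset.sum_congr rfl (fun n _ => hred n)] at t ⊢
    simp only [hred] at t ⊢
    linarith

lemma rpow_diff (α x : ℝ) (h1 : α ≤ 1) (hx : 0 < x) :
    x ^ (-α) - (x + 1) ^ (-α) ≤ x ^ (-α - 1) := by
  have e1 : (x + 1) ^ (-α) = x ^ (-α) * (1 + 1 / x) ^ (-α) := by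
    rw [← Real.mul_rpow hx.le (by positivity)]; congr 1; field_simp
  have e2 : (1 + 1 / x) ^ (-1 : ℝ) ≤ (1 + 1 / x) ^ (-α) :=
    Real.rpow_le_rpow_of_exponent_le (by simp; positivity) (by linarith)
  have e3 : 1 - 1 / x ≤ (1 + 1 / x) ^ (-1 : ℝ) := by
    rw [Real.rpow_neg_one, ← one_div, le_div_iff₀ (by positivity)]
    have : 0 < 1 / x := by positivity
    nlinarith
  have e4 : x ^ (-α - 1) = x ^ (-α) * (1 / x) := by
    rw [Real.rpow_sub hx, Real.rpow_one]; ring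
  have : 0 < x ^ (-α) := by positivity
  rw [e1, e4]
  nlinarith

/-- Abel summation. -/
lemma abel_sum (α : ℝ) (h0 : 3 / 4 < α) (h1 : α < 1) : ∃ C : ℝ, ∀ w : ℕ → ℂ,
    (∀ m : ℕ, ‖∑ n ∈ Finset.range m, w n‖ ≤ 20 * ((m : ℝ) + 1) ^ (3 / 4 : ℝ)) →
    (∀ N : ℕ, ‖∑ n ∈ Finset.range N, ((((n : ℝ) + 1) ^ (-α) : ℝ) : ℂ) * w n‖ ≤ C) ∧
    ∃ L : ℂ, Tendsto (fun N => ∑ n ∈ Finset.range N, ((((n : ℝ) + 1) ^ (-α) : ℝ) : ℂ) * w n)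
      atTop (𝓝 L) := by
  set h : ℕ → ℝ := fun i => 40 * ((i : ℝ) + 1) ^ (-α - 1 / 4) with hh
  have hsum : Summable h := by
    apply Summable.mul_left
    have := (summable_nat_add_iff 1).2 (Real.summable_nat_rpow (p := -α - 1 / 4) |>.2 (by linarith))
    simpa using this
  have hnn : ∀ i, 0 ≤ h i := fun i => by simp only [hh]; positivity
  refine ⟨40 + ∑' i, h i, fun w hw => ?_⟩
  set f : ℕ → ℝ := fun n => ((n : ℝ) + 1) ^ (-α) with hf
  set G : ℕ → ℂ := fun m => ∑ n ∈ Finset.range m, w n with hG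
  have hG' : ∀ m : ℕ, ‖G (m + 1)‖ ≤ 40 * ((m : ℝ) + 1) ^ (3 / 4 : ℝ) := by
    intro m
    refine (hw (m + 1)).trans ?_
    have hm0 : (0 : ℝ) ≤ m := Nat.cast_nonneg m
    have : (((m + 1 : ℕ) : ℝ) + 1) ^ (3 / 4 : ℝ) ≤ 2 * ((m : ℝ) + 1) ^ (3 / 4 : ℝ) := by
      calc (((m + 1 : ℕ) : ℝ) + 1) ^ (3 / 4 : ℝ) ≤ (2 * ((m : ℝ) + 1)) ^ (3 / 4 : ℝ) := by
            apply Real.rpow_le_rpow (by positivity) (by push_cast; linarith) (by norm_num)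
        _ = 2 ^ (3 / 4 : ℝ) * ((m : ℝ) + 1) ^ (3 / 4 : ℝ) := Real.mul_rpow (by norm_num) (by linarith)
        _ ≤ 2 * ((m : ℝ) + 1) ^ (3 / 4 : ℝ) := by
            gcongr
            calc (2 : ℝ) ^ (3 / 4 : ℝ) ≤ 2 ^ (1 : ℝ) :=
                  Real.rpow_le_rpow_of_exponent_le (by norm_num) (by norm_num)
              _ = 2 := Real.rpow_one 2
    linarith
  set T : ℕ → ℂ := fun i => ((f (i + 1) : ℂ) - (f i : ℂ)) * G (i + 1) with hT
  have hTb : ∀ i, ‖T i‖ ≤ h i := by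
    intro i
    have hi0 : (0 : ℝ) < (i : ℝ) + 1 := by positivity
    have d := rpow_diff α ((i : ℝ) + 1) h1.le hi0
    have mono : ((i : ℝ) + 1 + 1) ^ (-α) ≤ ((i : ℝ) + 1) ^ (-α) :=
      Real.rpow_le_rpow_of_nonpos hi0 (by linarith) (by linarith)
    have e : ‖(f (i + 1) : ℂ) - (f i : ℂ)‖ ≤ ((i : ℝ) + 1) ^ (-α - 1) := by
      rw [← Complex.ofReal_sub, Complex.norm_real, Real.norm_eq_abs, abs_sub_comm]
      simp only [hf]
      push_cast
      rw [abs_of_nonneg (by linarith)]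
      exact d
    simp only [hT, norm_mul]
    calc _ ≤ ((i : ℝ) + 1) ^ (-α - 1) * (40 * ((i : ℝ) + 1) ^ (3 / 4 : ℝ)) := by
          gcongr
          exact hG' i
      _ = h i := by
          simp only [hh]
          rw [show -α - 1 / 4 = (-α - 1) + 3 / 4 by ring, Real.rpow_add hi0]
          ring
  have hTs : Summable T := Summable.of_norm_bounded hsum hTb
  have bdry : ∀ N : ℕ, ‖(f N : ℂ) * G (N + 1)‖ ≤ 40 * ((N : ℝ) + 1) ^ (-(α - 3 / 4)) := by
    intro N
    have hi0 : (0 : ℝ) < (N : ℝ) + 1 := by positivity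
    have : 0 ≤ f N := by simp only [hf]; positivity
    rw [norm_mul, Complex.norm_real, Real.norm_of_nonneg this]
    calc _ ≤ f N * (40 * ((N : ℝ) + 1) ^ (3 / 4 : ℝ)) := by gcongr; exact hG' N
      _ = _ := by
          simp only [hf]
          rw [show -(α - 3 / 4) = -α + 3 / 4 by ring, Real.rpow_add hi0]
          ring
  have parts : ∀ N, ∑ n ∈ Finset.range (N + 1), (f n : ℂ) * w n
      = (f N : ℂ) * G (N + 1) - ∑ i ∈ Finset.range N, T i := by
    intro N
    have := Finset.sum_range_by_parts (fun n => (f n : ℂ)) w (N + 1)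
    simpa [hT, hG] using this
  constructor
  · intro N
    cases N with
    | zero => simpa using add_nonneg (by norm_num) (tsum_nonneg hnn)
    | succ N =>
      rw [parts]
      refine (norm_sub_le _ _).trans (add_le_add ((bdry N).trans ?_) ?_)
      · have : ((N : ℝ) + 1) ^ (-(α - 3 / 4)) ≤ 1 :=
          Real.rpow_le_one_of_one_le_of_nonpos (by simp) (by linarith)
        linarith
      · refine (norm_sum_le _ _).trans ((Finset.sum_le_sum fun i _ => hTb i).trans ?_)
        exact hsum.sum_le_tsum _ (fun i _ => hnn i)
  · refine ⟨0 - ∑' i, T i, ?_⟩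
    rw [← tendsto_add_atTop_iff_nat 1]
    refine Tendsto.congr (fun N => (parts N).symm) ?_
    refine Tendsto.sub ?_ hTs.hasSum.tendsto_sum_nat
    refine squeeze_zero_norm bdry ?_
    have t1 : Tendsto (fun N : ℕ => (N : ℝ) + 1) atTop atTop :=
      tendsto_atTop_add_const_right _ _ tendsto_natCast_atTop_atTop
    have := ((tendsto_rpow_neg_atTop (y := α - 3 / 4) (by linarith)).comp t1).const_mul 40
    simpa using this

lemma weighted (α : ℝ) (h0 : 3 / 4 < α) (h1 : α < 1) : ∃ C : ℝ, ∀ ω β : ℝ, 1 ≤ β → β ≤ 2 →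
    (∀ N : ℕ, ‖∑ n ∈ Finset.range N, ((((n : ℝ) + 1) ^ (-α) : ℝ) : ℂ) *
      ee (ω * ((n + 1 : ℕ) : ℝ) + β * √((n + 1 : ℕ) : ℝ))‖ ≤ C) ∧
    ∃ L : ℂ, Tendsto (fun N => ∑ n ∈ Finset.range N, ((((n : ℝ) + 1) ^ (-α) : ℝ) : ℂ) *
      ee (ω * ((n + 1 : ℕ) : ℝ) + β * √((n + 1 : ℕ) : ℝ)))
      atTop (𝓝 L) := by
  obtain ⟨C, hC⟩ := abel_sum α h0 h1
  exact ⟨C, fun ω β hb1 hb2 => hC _ (expsum ω β hb1 hb2)⟩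

/-- **Example (non-Szegő perturbation).** Let `α ∈ (3/4, 1)` and
`δb_n = n^{-α} cos(2π√n)`. Then: (i) `Σ δb_n² < ∞` but `Σ |δb_n| = ∞`; (ii) for every
`ω ∈ [0,1]` the series `Σ e^{2πinω} δb_n` converges; (iii) the partial sums are uniformly
bounded in `ω ∈ [0,1]` and `N`. -/
theorem example_sqrt_frequency
    (α : ℝ) (hα : α ∈ Set.Ioo (3 / 4 : ℝ) 1)
    (δb : ℕ → ℝ)
    (hδb : ∀ n : ℕ, δb n = (n : ℝ) ^ (-α) * Real.cos (2 * Real.pi * Real.sqrt n)) :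
    ((Summable fun n : ℕ => δb (n + 1) ^ 2) ∧ ¬ Summable fun n : ℕ => |δb (n + 1)|) ∧
    (∀ ω ∈ Set.Icc (0 : ℝ) 1, ∃ L : ℂ,
      Tendsto (fun N => ∑ n ∈ Finset.Icc 1 N,
        Complex.exp (2 * Real.pi * Complex.I * (n : ℕ) * (ω : ℝ)) * (δb n : ℂ))
        atTop (𝓝 L)) ∧
    (∃ C : ℝ, ∀ ω ∈ Set.Icc (0 : ℝ) 1, ∀ N : ℕ,
      ‖∑ n ∈ Finset.Icc 1 N,
        Complex.exp (2 * Real.pi * Complex.I * (n : ℕ) * (ω : ℝ)) * (δb n : ℂ)‖ ≤ C) := by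
  obtain ⟨h0, h1⟩ := hα
  obtain ⟨C, hC⟩ := weighted α h0 h1
  set S : ℝ → ℝ → ℕ → ℂ := fun ω β N => ∑ n ∈ Finset.range N, ((((n : ℝ) + 1) ^ (-α) : ℝ) : ℂ) *
      ee (ω * ((n + 1 : ℕ) : ℝ) + β * √((n + 1 : ℕ) : ℝ)) with hS
  have hrep : ∀ ω : ℝ, ∀ N : ℕ, ∑ n ∈ Finset.Icc 1 N,
        Complex.exp (2 * Real.pi * Complex.I * (n : ℕ) * (ω : ℝ)) * (δb n : ℂ)
      = 1 / 2 * (S ω 1 N + (starRingEnd ℂ) (S (-ω) 1 N)) := by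
    intro ω N
    have e : Finset.Icc 1 N = Finset.Ico 1 (N + 1) := by ext; simp
    rw [e, Finset.sum_Ico_eq_sum_range, Nat.add_sub_cancel]
    simp only [hS, map_sum, ← Finset.sum_add_distrib, Finset.mul_sum]
    refine Finset.sum_congr rfl fun n _ => ?_
    rw [hδb, map_mul, Complex.conj_ofReal, add_comm 1 n]
    unfold ee
    rw [← Complex.exp_conj]
    simp only [map_mul, Complex.conj_ofReal, Complex.conj_I]
    generalize √((n + 1 : ℕ) : ℝ) = r
    rw [Complex.ofReal_mul, Complex.ofReal_cos, Complex.cos]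
    have a1 : Complex.exp (((2 * Real.pi * (ω * ((n + 1 : ℕ) : ℝ) + 1 * r) : ℝ) : ℂ) * Complex.I)
      = Complex.exp (2 * Real.pi * Complex.I * (n + 1 : ℕ) * (ω : ℝ)) *
        Complex.exp (((2 * Real.pi * r : ℝ) : ℂ) * Complex.I) := by
      rw [← Complex.exp_add]; congr 1; push_cast; ring
    have a2 : Complex.exp (((2 * Real.pi * (-ω * ((n + 1 : ℕ) : ℝ) + 1 * r) : ℝ) : ℂ) * -Complex.I)
      = Complex.exp (2 * Real.pi * Complex.I * (n + 1 : ℕ) * (ω : ℝ)) *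
        Complex.exp (-((2 * Real.pi * r : ℝ) : ℂ) * Complex.I) := by
      rw [← Complex.exp_add]; congr 1; push_cast; ring
    rw [a1, a2]
    push_cast
    ring
  refine ⟨⟨?_, ?_⟩, ?_, ?_⟩
  · have hs : Summable fun n : ℕ => ((n + 1 : ℕ) : ℝ) ^ (-(2 * α)) :=
      (summable_nat_add_iff 1).2 (Real.summable_nat_rpow (p := -(2 * α)) |>.2 (by linarith))
    refine Summable.of_nonneg_of_le (fun n => sq_nonneg _) (fun n => ?_) hs
    rw [hδb, mul_pow, ← Real.rpow_natCast, ← Real.rpow_mul (by positivity)]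
    have e : -α * ((2 : ℕ) : ℝ) = -(2 * α) := by push_cast; ring
    rw [e]
    have := Real.cos_sq_le_one (2 * Real.pi * √((n + 1 : ℕ) : ℝ))
    exact mul_le_of_le_one_right (by positivity) this
  · intro hsum
    have hdiv : ¬ Summable fun n : ℕ => ((n + 1 : ℕ) : ℝ) ^ (-α) := by
      intro h
      have := (summable_nat_add_iff (f := fun n : ℕ => (n : ℝ) ^ (-α)) 1).1 h
      have := Real.summable_nat_rpow.1 this
      linarith
    apply hdiv
    refine summable_of_sum_range_le (c := 2 * (∑' n, |δb (n + 1)|) + C) (fun n => by positivity) ?_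
    intro N
    have hb := ((hC 0 2 (by norm_num) le_rfl).1 N)
    have hre := (Complex.abs_re_le_norm _).trans hb
    rw [Complex.re_sum] at hre
    have hle := (abs_le.1 hre).1
    have ht := hsum.sum_le_tsum (Finset.range N) (fun i _ => abs_nonneg _)
    have hterm : ∀ n ∈ Finset.range N, ((n + 1 : ℕ) : ℝ) ^ (-α) ≤ 2 * |δb (n + 1)| -
        (((((n : ℝ) + 1) ^ (-α) : ℝ) : ℂ) *
          ee (0 * ((n + 1 : ℕ) : ℝ) + 2 * √((n + 1 : ℕ) : ℝ))).re := by
      intro n _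
      rw [Complex.re_ofReal_mul, hδb, abs_mul, abs_of_nonneg (by positivity)]
      unfold ee
      rw [Complex.exp_ofReal_mul_I_re]
      have e : 2 * Real.pi * (0 * ((n + 1 : ℕ) : ℝ) + 2 * √((n + 1 : ℕ) : ℝ))
        = 2 * (2 * Real.pi * √((n + 1 : ℕ) : ℝ)) := by ring
      rw [e, Real.cos_two_mul]
      have hc := Real.abs_cos_le_one (2 * Real.pi * √((n + 1 : ℕ) : ℝ))
      have hc0 := abs_nonneg (Real.cos (2 * Real.pi * √((n + 1 : ℕ) : ℝ)))
      rw [← sq_abs (Real.cos _)]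
      have hp : (0 : ℝ) ≤ ((n + 1 : ℕ) : ℝ) ^ (-α) := by positivity
      have e2 : ((n : ℝ) + 1) ^ (-α) = ((n + 1 : ℕ) : ℝ) ^ (-α) := by push_cast; rfl
      rw [e2]
      generalize ((n + 1 : ℕ) : ℝ) ^ (-α) = p at *
      generalize |Real.cos (2 * Real.pi * √((n + 1 : ℕ) : ℝ))| = c at *
      nlinarith [mul_nonneg hp (mul_nonneg hc0 (sub_nonneg.2 hc))]
    have := Finset.sum_le_sum hterm
    rw [Finset.sum_sub_distrib, ← Finset.mul_sum] at this
    linarith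
  · intro ω _
    obtain ⟨L1, hL1⟩ := (hC ω 1 le_rfl (by norm_num)).2
    obtain ⟨L2, hL2⟩ := (hC (-ω) 1 le_rfl (by norm_num)).2
    refine ⟨1 / 2 * (L1 + (starRingEnd ℂ) L2), ?_⟩
    simp only [hrep]
    exact (hL1.add ((Complex.continuous_conj.tendsto L2).comp hL2)).const_mul _
  · refine ⟨C, fun ω _ N => ?_⟩
    rw [hrep, norm_mul]
    have b1 := (hC ω 1 le_rfl (by norm_num)).1 N
    have b2 := (hC (-ω) 1 le_rfl (by norm_num)).1 N
    have := norm_add_le (S ω 1 N) ((starRingEnd ℂ) (S (-ω) 1 N))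
    rw [Complex.norm_conj] at this
    have e : ‖(1 / 2 : ℂ)‖ = 1 / 2 := by norm_num
    rw [e]
    simp only [hS] at this ⊢
    linarith
end
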